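/- arXiv:2206.10752 — 4 statements merged into one kernel-verified Lean document; each statement's English description precedes it below -/
import Mathlib

section
/- Let G be a finite nonabelian group that is minimally faithful of degree 2. Then either G is isomorphic to the quaternion group Q_8 of order 8, or there exist an odd prime p and an integer m ≥ 1 such that G is isomorphic to the semidirect product C_p ⋊ C_{2^m} in which a generator of the cyclic group C_{2^m} acts on the cyclic group C_p by inversion (g ↦ g⁻¹). -/
/-- `rdim G` is the smallest `n` such that `G` has a faithful `n`-dimensional
complex representation, i.e. an injective group homomorphism `G →* GL n ℂ`. -/
noncomputable def rdim (G : Type*) [Group G] : ℕ :=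
  sInf {n : ℕ | ∃ ρ : G →* GL (Fin n) ℂ, Function.Injective ρ}

/-- `G` is minimally faithful of degree `n` if `rdim G = n` and every proper
subgroup has strictly smaller representation dimension. -/
def MinFaithful (G : Type*) [Group G] (n : ℕ) : Prop :=
  rdim G = n ∧ ∀ H : Subgroup G, H ≠ ⊤ → rdim H < n


lemma mat_pow_lin (A : Matrix (Fin 2) (Fin 2) ℂ) (r : ℕ) :
    ∃ u v : ℂ, A ^ r = u • A + v • (1 : Matrix (Fin 2) (Fin 2) ℂ) := by
  have hsq : A * A = A.trace • A - A.det • (1 : Matrix (Fin 2) (Fin 2) ℂ) := by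
    ext i j
    fin_cases i <;> fin_cases j <;>
      simp [Matrix.mul_apply, Fin.sum_univ_two, Matrix.trace_fin_two, Matrix.det_fin_two] <;> ring
  induction r with
  | zero => exact ⟨0, 1, by simp⟩
  | succ r ih =>
    obtain ⟨u, v, h⟩ := ih
    refine ⟨u * A.trace + v, - (u * A.det), ?_⟩
    rw [pow_succ, h, add_mul, smul_mul_assoc, hsq, smul_mul_assoc, one_mul]
    module

lemma mat_nil (A : Matrix (Fin 2) (Fin 2) ℂ) (c : ℂ) (n : ℕ) (hA : A * A = 0) :
    (c • (1 : Matrix (Fin 2) (Fin 2) ℂ) + A) ^ (n + 1) =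
      c ^ (n + 1) • (1 : Matrix (Fin 2) (Fin 2) ℂ) + ((n + 1 : ℂ) * c ^ n) • A := by
  induction n with
  | zero => simp
  | succ n ih =>
    rw [pow_succ, ih]
    simp only [add_mul, mul_add, smul_mul_assoc, mul_smul_comm, one_mul, mul_one, hA, smul_zero]
    push_cast
    module

lemma mat_key (A B B' : Matrix (Fin 2) (Fin 2) ℂ) (n : ℕ) (hn : A ^ (n + 1) = 1)
    (hB : B * B' = 1) (r : ℕ) (hr : B * A = A ^ r * B) : B * B * A = A * (B * B) := by
  obtain ⟨u, v, huv⟩ := mat_pow_lin A r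
  obtain ⟨c, hc⟩ : ∃ c : ℂ, c = A.trace / 2 := ⟨_, rfl⟩
  obtain ⟨X, hX⟩ : ∃ X, X = A - c • (1 : Matrix (Fin 2) (Fin 2) ℂ) := ⟨_, rfl⟩
  have hAX : A = c • (1 : Matrix (Fin 2) (Fin 2) ℂ) + X := by rw [hX]; abel
  have htr : X.trace = 0 := by
    rw [hX, Matrix.trace_sub, Matrix.trace_smul, Matrix.trace_one, hc]; simp
  have hXX : X * X = (-X.det) • (1 : Matrix (Fin 2) (Fin 2) ℂ) := by
    rw [Matrix.trace_fin_two] at htr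
    have h1 : X 1 1 = - X 0 0 := by linear_combination htr
    ext i j
    fin_cases i <;> fin_cases j <;>
      simp [Matrix.mul_apply, Fin.sum_univ_two, Matrix.det_fin_two, h1] <;> ring
  by_cases hd : X.det = 0
  · have hXX0 : X * X = 0 := by rw [hXX, hd]; simp
    have h1 := mat_nil X c n hXX0
    rw [← hAX, hn] at h1
    have h2 := congrArg Matrix.trace h1
    simp [htr] at h2
    have hc1 : c ^ (n + 1) = 1 := h2
    have hc0 : c ≠ 0 := by rintro rfl; simp at hc1
    rw [hc1, one_smul, left_eq_add, smul_eq_zero] at h1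
    have hX0 : X = 0 := by
      rcases h1 with h1 | h1
      · exact absurd h1 (mul_ne_zero (by exact_mod_cast Nat.succ_ne_zero n) (pow_ne_zero _ hc0))
      · exact h1
    rw [hAX, hX0]; simp
  · obtain ⟨e, he⟩ : ∃ e : ℂ, e = v + u * c - c := ⟨_, rfl⟩
    have h1 : B * X = u • (X * B) + e • B := by
      have h2 : B * X = B * A - c • B := by rw [hX, mul_sub]; simp
      rw [h2, hr, huv, hAX, he]
      simp only [add_mul, smul_add, smul_mul_assoc, one_mul]
      module
    have hB2 : B' * B = 1 := mul_eq_one_comm.mp hB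
    have he0 : e = 0 := by
      have h2 : B * X * B' = u • X + e • (1 : Matrix (Fin 2) (Fin 2) ℂ) := by
        rw [h1, add_mul, smul_mul_assoc, smul_mul_assoc, mul_assoc, hB, mul_one]
      have h3 := congrArg Matrix.trace h2
      rw [Matrix.trace_mul_comm, ← mul_assoc, hB2, one_mul] at h3
      simpa [htr] using h3
    rw [he0, zero_smul, add_zero] at h1
    have h4 : B * (X * X) = (u * u) • (X * X * B) := by
      rw [← mul_assoc, h1, smul_mul_assoc, mul_assoc, h1, mul_smul_comm, smul_smul, mul_assoc]
    have hu : u * u = 1 := by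
      rw [hXX] at h4
      have h5 := congrArg (fun M => (M * B').trace) h4
      simp [hB] at h5
      have h6 : X.det * 2 * (u * u - 1) = 0 := by linear_combination -h5
      rcases mul_eq_zero.mp h6 with h | h
      · exact absurd h (mul_ne_zero hd two_ne_zero)
      · linear_combination h
    have h7 : B * B * X = X * (B * B) := by
      rw [mul_assoc, h1, mul_smul_comm, ← mul_assoc, h1, smul_mul_assoc, smul_smul, hu, one_smul,
        mul_assoc]
    rw [hAX, mul_add, add_mul, h7]; simp

lemma rep_key {G : Type*} [Group G] [Finite G] (ρ : G →* GL (Fin 2) ℂ)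
    (hρ : Function.Injective ρ) (y k : G) (hk : k * y * k⁻¹ ∈ Subgroup.zpowers y) :
    k * k * y = y * (k * k) := by
  obtain ⟨r, hr⟩ := (mem_powers_iff_mem_zpowers (x := y)).mpr hk
  obtain ⟨n, hn⟩ := Nat.exists_eq_succ_of_ne_zero (orderOf_pos y).ne'
  have hyn : y ^ (n + 1) = 1 := by rw [← Nat.succ_eq_add_one, ← hn, pow_orderOf_eq_one]
  apply hρ
  apply Units.ext
  have hr' : k * y = y ^ r * k := by
    have : y ^ r = k * y * k⁻¹ := hr
    rw [this]; group
  have := mat_key (ρ y : Matrix (Fin 2) (Fin 2) ℂ) (ρ k : Matrix (Fin 2) (Fin 2) ℂ)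
    ((ρ k)⁻¹ : GL (Fin 2) ℂ) n
    (by rw [← Units.val_pow_eq_pow_val, ← map_pow, hyn]; simp) (by simp) r
    (by rw [← Units.val_pow_eq_pow_val, ← map_pow, ← Units.val_mul, ← map_mul, hr']; simp)
  simpa using this

lemma get_rep {G : Type*} [Group G] (h : MinFaithful G 2) :
    ∃ ρ : G →* GL (Fin 2) ℂ, Function.Injective ρ := by
  have h1 := h.1
  have := Nat.sInf_mem (Nat.nonempty_of_pos_sInf (by unfold rdim at h1; rw [h1]; norm_num))
  unfold rdim at h1
  rw [h1] at this
  exact this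

lemma get_cyc {G : Type*} [Group G] [Finite G] (h : MinFaithful G 2) (H : Subgroup G)
    (hH : H ≠ ⊤) : IsCyclic H := by
  obtain ⟨ρ, hρ⟩ := get_rep h
  have h1 := h.2 H hH
  have hne : {n : ℕ | ∃ ρ : H →* GL (Fin n) ℂ, Function.Injective ρ}.Nonempty :=
    ⟨2, ρ.comp H.subtype, hρ.comp H.subtype_injective⟩
  obtain ⟨d, hd, σ, hσ⟩ : ∃ d : ℕ, d < 2 ∧ ∃ σ : H →* GL (Fin d) ℂ, Function.Injective σ :=
    ⟨rdim H, h1, Nat.sInf_mem hne⟩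
  interval_cases d
  · have : Subsingleton H := hσ.subsingleton
    infer_instance
  · refine isCyclic_of_injective_ringHom
      ((Units.coeHom ℂ).comp ((Matrix.GeneralLinearGroup.det).comp σ)) ?_
    intro a b hab
    apply hσ
    apply Units.ext
    ext i j
    fin_cases i; fin_cases j
    simpa [Matrix.det_fin_one] using hab


section
open Subgroup
variable {G : Type*} [Group G]

/-- Commuting generators give a commutative group. -/
lemma comm_of_gen (a b : G) (hab : a * b = b * a) (htop : closure {a, b} = ⊤) (x y : G) :
    x * y = y * x := by
  have h1 : ∀ z ∈ closure {a, b}, z ∈ centralizer {a, b} := by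
    intro z hz
    induction hz using closure_induction with
    | mem x hx =>
      rw [mem_centralizer_iff]
      rintro h (rfl | rfl) <;> rcases hx with rfl | rfl <;> simp [hab]
    | one => exact one_mem _
    | mul x y _ _ hx hy => exact mul_mem hx hy
    | inv x _ hx => exact inv_mem hx
  have h2 : closure {a, b} ≤ centralizer {x} := by
    rw [closure_le]
    intro w hw
    rw [SetLike.mem_coe, mem_centralizer_iff]
    rintro h rfl
    have := h1 h (htop ▸ mem_top _)
    rw [mem_centralizer_iff] at this
    exact (this w hw).symm
  have h3 := h2 (htop ▸ mem_top y)
  rw [mem_centralizer_iff] at h3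
  exact h3 x rfl

lemma closure_ne_top (hna : ¬ ∀ a b : G, a * b = b * a) (a b : G) (hab : a * b = b * a) :
    closure {a, b} ≠ ⊤ := fun h => hna (comm_of_gen a b hab h)

lemma closure_top (hcyc : ∀ H : Subgroup G, H ≠ ⊤ → IsCyclic H) (a b : G)
    (hab : a * b ≠ b * a) : closure {a, b} = ⊤ := by
  by_contra h
  have := hcyc _ h
  let _ : CommGroup (closure {a, b}) := IsCyclic.commGroup
  have h1 := mul_comm (⟨a, subset_closure (by simp)⟩ : closure {a, b})
    ⟨b, subset_closure (by simp)⟩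
  exact hab (congrArg Subtype.val h1)

lemma unique_inv [Finite G] (hna : ¬ ∀ a b : G, a * b = b * a)
    (hcyc : ∀ H : Subgroup G, H ≠ ⊤ → IsCyclic H) (x c : G) (hxc : x * c = c * x)
    (hx : x * x = 1) (hc : c * c = 1) (hc1 : c ≠ 1) : x = 1 ∨ x = c := by
  classical
  have := hcyc _ (closure_ne_top hna x c hxc)
  obtain ⟨X, hX⟩ : ∃ X : closure {x, c}, X.1 = x := ⟨⟨x, subset_closure (by simp)⟩, rfl⟩
  obtain ⟨C, hC⟩ : ∃ C : closure {x, c}, C.1 = c := ⟨⟨c, subset_closure (by simp)⟩, rfl⟩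
  have _ := Fintype.ofFinite (closure {x, c})
  have hle := IsCyclic.card_pow_eq_one_le (α := closure {x, c}) (n := 2) (by norm_num)
  by_contra! hne
  have hsub : ({1, C, X} : Finset (closure {x, c})) ⊆ Finset.univ.filter (fun a => a ^ 2 = 1) := by
    intro a ha
    simp only [Finset.mem_insert, Finset.mem_singleton] at ha
    simp only [Finset.mem_filter, Finset.mem_univ, true_and]
    rcases ha with rfl | rfl | rfl
    · simp
    · apply Subtype.ext; simp [hC, pow_two, hc]
    · apply Subtype.ext; simp [hX, pow_two, hx]
  have h3 : ({1, C, X} : Finset (closure {x, c})).card = 3 := by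
    rw [Finset.card_eq_three]
    refine ⟨1, C, X, ?_, ?_, ?_, rfl⟩
    · rintro rfl; exact hc1 (by simpa using hC.symm)
    · rintro rfl; exact hne.1 (by simpa using hX.symm)
    · rintro rfl; exact hne.2 (hX.symm.trans hC)
  have := Finset.card_le_card hsub
  convert absurd (this.trans hle) (by rw [h3]; norm_num)

/-- The homomorphism from the cyclic group determined by an element. -/
lemma exists_zhom (n : ℕ) (g : G) (hg : g ^ n = 1) :
    ∃ f : Multiplicative (ZMod n) →* G, ∀ i : ℤ, f (Multiplicative.ofAdd (i : ZMod n)) = g ^ i := by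
  refine ⟨AddMonoidHom.toMultiplicativeLeft
    (ZMod.lift n ⟨(zmultiplesHom (Additive G)) (Additive.ofMul g), ?_⟩), ?_⟩
  · rw [zmultiplesHom_apply, ← ofMul_zpow]
    simp [hg]
  · intro i
    change Additive.toMul (ZMod.lift n _ (i : ZMod n)) = _
    rw [ZMod.lift_coe]
    simp

lemma inv_conj_pow (z k : G) (h : k * z * k⁻¹ = z⁻¹) (q : ℕ) (hq : Odd q) :
    k ^ q * z * (k ^ q)⁻¹ = z⁻¹ := by
  obtain ⟨r, rfl⟩ := hq
  have h2 : Commute (k * k) z := by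
    have h3 : k * z⁻¹ * k⁻¹ = z := by
      have := congrArg (·⁻¹) h
      simpa [mul_assoc] using this
    have : k * k * z = z * (k * k) := by
      calc k * k * z = k * (k * z * k⁻¹) * k⁻¹ * (k * k) := by group
        _ = z * (k * k) := by rw [h, h3]
    exact this
  have h3 : Commute ((k * k) ^ r) z := h2.pow_left r
  have h4 : k ^ (2 * r + 1) = k * (k * k) ^ r := by rw [← pow_two, ← pow_mul, pow_succ']
  rw [h4, mul_inv_rev, mul_assoc k, h3.eq, ← h]
  group

lemma final_semi [Finite G] (hcyc : ∀ H : Subgroup G, H ≠ ⊤ → IsCyclic H) (p : ℕ) (hp : p.Prime)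
    (hodd : Odd p) (z k₀ : G) (hz : orderOf z = p) (hk₀ : k₀ * z * k₀⁻¹ = z⁻¹) :
    ∃ p m : ℕ, p.Prime ∧ Odd p ∧ 1 ≤ m ∧
      ∃ φ : Multiplicative (ZMod (2 ^ m)) →* MulAut (Multiplicative (ZMod p)),
        (∀ g : Multiplicative (ZMod p), φ (Multiplicative.ofAdd 1) g = g⁻¹) ∧
        Nonempty (G ≃* (Multiplicative (ZMod p) ⋊[φ] Multiplicative (ZMod (2 ^ m)))) := by
  obtain ⟨m, q, hq, hmq⟩ := Nat.exists_eq_two_pow_mul_odd (orderOf_pos k₀).ne'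
  obtain ⟨k, hk⟩ : ∃ k, k = k₀ ^ q := ⟨_, rfl⟩
  have hkz : k * z * k⁻¹ = z⁻¹ := hk ▸ inv_conj_pow z k₀ hk₀ q hq
  have hko : orderOf k = 2 ^ m := by
    rw [hk, orderOf_pow_of_dvd hq.pos.ne' (hmq ▸ Dvd.intro_left _ rfl), hmq,
      Nat.mul_div_cancel _ hq.pos]
  have hzz : z ≠ z⁻¹ := by
    intro h
    have : z ^ 2 = 1 := by rw [pow_two]; nth_rewrite 2 [h]; simp
    have := orderOf_dvd_of_pow_eq_one this
    rw [hz, Nat.prime_dvd_prime_iff_eq hp Nat.prime_two] at this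
    subst this
    exact absurd hodd (by decide)
  have hncomm : z * k ≠ k * z := by
    intro h
    rw [← h] at hkz
    exact hzz (by simpa using hkz)
  have htop := closure_top hcyc z k hncomm
  have hm : 1 ≤ m := by
    rcases Nat.eq_zero_or_pos m with rfl | h
    · have : k = 1 := by rw [← orderOf_eq_one_iff, hko]; rfl
      subst this
      simp at hncomm
    · exact h
  obtain ⟨φ, hφ⟩ := exists_zhom (2 ^ m) (MulEquiv.inv (Multiplicative (ZMod p)) :
      MulAut (Multiplicative (ZMod p))) (by
    obtain ⟨l, rfl⟩ := Nat.exists_eq_add_of_le hm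
    rw [pow_add, pow_one, pow_mul]
    have : (MulEquiv.inv (Multiplicative (ZMod p)) : MulAut (Multiplicative (ZMod p))) ^ 2 = 1 := by
      rw [pow_two]; ext x; simp
    rw [this, one_pow])
  obtain ⟨fn, hfn⟩ := exists_zhom p z (by rw [← hz, pow_orderOf_eq_one])
  obtain ⟨fg, hfg⟩ := exists_zhom (2 ^ m) k (by rw [← hko, pow_orderOf_eq_one])
  have hφ1 : ∀ g : Multiplicative (ZMod p), φ (Multiplicative.ofAdd 1) g = g⁻¹ := by
    intro g
    have := hφ 1
    rw [Int.cast_one, zpow_one] at this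
    rw [this]; rfl
  refine ⟨p, m, hp, hodd, hm, φ, hφ1, ?_⟩
  have hgen1 : ∀ x : Multiplicative (ZMod p), ∃ i : ℤ, x = Multiplicative.ofAdd (i : ZMod p) := by
    intro x
    obtain ⟨i, hi⟩ := ZMod.intCast_surjective (Multiplicative.toAdd x)
    exact ⟨i, by rw [hi]; rfl⟩
  have hgen2 : ∀ x : Multiplicative (ZMod (2 ^ m)),
      ∃ i : ℤ, x = Multiplicative.ofAdd (i : ZMod (2 ^ m)) := by
    intro x
    obtain ⟨i, hi⟩ := ZMod.intCast_surjective (Multiplicative.toAdd x)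
    exact ⟨i, by rw [hi]; rfl⟩
  have hgen3 : ∀ x : Multiplicative (ZMod (2 ^ m)),
      ∃ i : ℕ, x = (Multiplicative.ofAdd (1 : ZMod (2 ^ m))) ^ i := by
    intro x
    refine ⟨(Multiplicative.toAdd x).val, ?_⟩
    rw [← ofAdd_nsmul]
    simp
  have hfg1 : fg (Multiplicative.ofAdd 1) = k := by simpa using hfg 1
  have hfn1 : fn (Multiplicative.ofAdd 1) = z := by simpa using hfn 1
  have hlift1 : ∀ n, fn (φ (Multiplicative.ofAdd 1) n) = k * fn n * k⁻¹ := by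
    intro n
    obtain ⟨i, rfl⟩ := hgen1 n
    rw [hφ1, map_inv, hfn, ← conj_zpow, hkz, inv_zpow]
  have hlift2 : ∀ (i : ℕ) n, fn (φ ((Multiplicative.ofAdd 1) ^ i) n) = k ^ i * fn n * (k ^ i)⁻¹ := by
    intro i
    induction i with
    | zero => intro n; simp
    | succ i ih =>
      intro n
      rw [pow_succ, map_mul, MulAut.mul_apply, ih, hlift1, pow_succ]
      group
  have hlift : ∀ g, fn.comp (φ g).toMonoidHom = (MulAut.conj (fg g)).toMonoidHom.comp fn := by
    intro g
    obtain ⟨i, rfl⟩ := hgen3 g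
    refine MonoidHom.ext fun n => ?_
    simp only [MonoidHom.comp_apply, MulEquiv.coe_toMonoidHom, MulAut.conj_apply]
    rw [hlift2, map_pow, hfg1]
  let F := SemidirectProduct.lift fn fg hlift
  have hsurj : Function.Surjective F := by
    rw [← MonoidHom.range_eq_top, eq_top_iff, ← htop, closure_le]
    rintro x (rfl | rfl)
    · exact ⟨SemidirectProduct.inl (Multiplicative.ofAdd 1), by
        rw [SemidirectProduct.lift_inl, hfn1]⟩
    · exact ⟨SemidirectProduct.inr (Multiplicative.ofAdd 1), by
        rw [SemidirectProduct.lift_inr, hfg1]⟩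
  have hinj : Function.Injective F := by
    rw [injective_iff_map_eq_one]
    rintro ⟨a, b⟩ hab
    obtain ⟨i, rfl⟩ := hgen1 a
    obtain ⟨j, rfl⟩ := hgen2 b
    change fn _ * fg _ = 1 at hab
    rw [hfn, hfg] at hab
    have hdis : Disjoint (zpowers z) (zpowers k) := by
      apply Subgroup.disjoint_of_coprime_natCard
      rw [Nat.card_zpowers, Nat.card_zpowers, hz, hko]
      exact Nat.Coprime.pow_right _ (Nat.coprime_two_right.mpr hodd)
    have hzi := (Subgroup.disjoint_iff_mul_eq_one.mp hdis)
      (zpow_mem (mem_zpowers z) i) (zpow_mem (mem_zpowers k) j) hab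
    have h1 : ((i : ℤ) : ZMod p) = 0 := by
      rw [ZMod.intCast_zmod_eq_zero_iff_dvd, ← hz]
      exact orderOf_dvd_iff_zpow_eq_one.mpr hzi.1
    have h2 : ((j : ℤ) : ZMod (2 ^ m)) = 0 := by
      rw [ZMod.intCast_zmod_eq_zero_iff_dvd, ← hko]
      exact orderOf_dvd_iff_zpow_eq_one.mpr hzi.2
    rw [h1, h2]; rfl
  exact ⟨(MulEquiv.ofBijective F ⟨hinj, hsurj⟩).symm⟩

lemma q8_iso [Finite G] (y t : G) (hy : y ^ 4 = 1) (ht : t * t = y * y) (hyt : y * t = t * y⁻¹)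
    (htop : closure {y, t} = ⊤) (hcard : Nat.card G = 8) : Nonempty (G ≃* QuaternionGroup 2) := by
  obtain ⟨E, hE⟩ := exists_zhom 4 y hy
  obtain ⟨e, he⟩ : ∃ e : ZMod (2 * 2) → G, ∀ i : ℤ, e (i : ZMod (2 * 2)) = y ^ i :=
    ⟨fun i => E (Multiplicative.ofAdd i), hE⟩
  have hs : ∀ x : ZMod (2 * 2), ∃ i : ℤ, x = (i : ZMod (2 * 2)) := by
    intro x
    obtain ⟨i, hi⟩ := ZMod.intCast_surjective x
    exact ⟨i, hi.symm⟩
  have hc : ∀ i : ℤ, y ^ i * t = t * y ^ (-i) := by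
    intro i
    have h1 : t⁻¹ * y * t = y⁻¹ := by rw [mul_assoc, hyt]; group
    have h2 : (t⁻¹ * y * t) ^ i = t⁻¹ * y ^ i * t := by
      have := conj_zpow (i := i) (a := t⁻¹) (b := y)
      simpa using this
    rw [zpow_neg, ← inv_zpow, ← h1, h2]; group
  let f : QuaternionGroup 2 → G := fun x => match x with
    | .a i => e i
    | .xa i => t * e i
  have hmul : ∀ u v, f (u * v) = f u * f v := by
    rintro (i | i) (j | j) <;> obtain ⟨i, rfl⟩ := hs i <;> obtain ⟨j, rfl⟩ := hs j
    · change e (_ + _) = e _ * e _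
      rw [← Int.cast_add, he, he, he, zpow_add]
    · change t * e (_ - _) = e _ * (t * e _)
      rw [← Int.cast_sub, he, he, he, ← mul_assoc, hc, mul_assoc, ← zpow_add]
      congr 2; ring
    · change t * e (_ + _) = (t * e _) * e _
      rw [← Int.cast_add, he, he, he, zpow_add, mul_assoc]
    · change e (((2 : ℕ) : ZMod (2 * 2)) + _ - _) = (t * e _) * (t * e _)
      have : (((2 : ℕ) : ZMod (2 * 2)) + (j : ZMod (2 * 2)) - (i : ZMod (2 * 2)))
        = ((2 + j - i : ℤ) : ZMod (2 * 2)) := by push_cast; rfl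
      rw [this, he, he, he]
      have h3 : t * y ^ i * (t * y ^ j) = t * (y ^ i * t) * y ^ j := by group
      rw [h3, hc, ← mul_assoc, ht]
      rw [← pow_two, ← zpow_natCast, ← zpow_add, ← zpow_add]
      congr 1; push_cast; ring
  let F : QuaternionGroup 2 →* G := MonoidHom.mk' f hmul
  have hsurj : Function.Surjective F := by
    rw [← MonoidHom.range_eq_top, eq_top_iff, ← htop, closure_le]
    rintro x (rfl | rfl)
    · refine ⟨.a ((1 : ℤ) : ZMod (2 * 2)), ?_⟩
      change e _ = _
      rw [he, zpow_one]
    · refine ⟨.xa ((0 : ℤ) : ZMod (2 * 2)), ?_⟩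
      change _ * e _ = _
      rw [he, zpow_zero, mul_one]
  have hbij : Function.Bijective F :=
    (Nat.bijective_iff_surjective_and_card F).mpr ⟨hsurj, by
      rw [hcard, Nat.card_eq_fintype_card, QuaternionGroup.card]⟩
  exact ⟨(MulEquiv.ofBijective F hbij).symm⟩

end

section
open Subgroup
variable {G : Type*} [Group G]

lemma case_z [Finite G] [IsZGroup G] (hna : ¬ ∀ a b : G, a * b = b * a)
    (hcyc : ∀ H : Subgroup G, H ≠ ⊤ → IsCyclic H)
    (hsq : ∀ y k : G, k * y * k⁻¹ ∈ zpowers y → k * k * y = y * (k * k)) :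
    ∃ p m : ℕ, p.Prime ∧ Odd p ∧ 1 ≤ m ∧
      ∃ φ : Multiplicative (ZMod (2 ^ m)) →* MulAut (Multiplicative (ZMod p)),
        (∀ g : Multiplicative (ZMod p), φ (Multiplicative.ofAdd 1) g = g⁻¹) ∧
        Nonempty (G ≃* (Multiplicative (ZMod p) ⋊[φ] Multiplicative (ZMod (2 ^ m)))) := by
  have hN := IsZGroup.isCyclic_commutator G
  have hA : IsCyclic (G ⧸ commutator G) := IsZGroup.isCyclic_abelianization (G := G)
  rw [Subgroup.isCyclic_iff_exists_zpowers_eq_top] at hN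
  obtain ⟨y, hy⟩ := hN
  obtain ⟨K, hK⟩ := hA.exists_generator
  obtain ⟨k, rfl⟩ := QuotientGroup.mk_surjective K
  have hgen : ∀ x : G, ∃ i : ℤ, ∃ j : ℤ, x = k ^ i * y ^ j := by
    intro x
    obtain ⟨i, hi⟩ := hK (x : G ⧸ commutator G)
    have hi' : ((k ^ i : G) : G ⧸ commutator G) = x := hi
    rw [QuotientGroup.eq, ← hy] at hi'
    obtain ⟨j, hj⟩ := hi'
    exact ⟨i, j, by change y ^ j = _ at hj; rw [hj]; group⟩
  have hyk : y * k ≠ k * y := by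
    intro h
    refine closure_ne_top hna y k h ?_
    rw [eq_top_iff]
    intro x _
    obtain ⟨i, j, rfl⟩ := hgen x
    exact mul_mem (zpow_mem (subset_closure (by simp)) _) (zpow_mem (subset_closure (by simp)) _)
  have hmem : k * y * k⁻¹ ∈ zpowers y := by
    rw [hy]
    exact (inferInstance : (commutator G).Normal).conj_mem y (hy ▸ mem_zpowers y) k
  have hkk := hsq y k hmem
  obtain ⟨w, hw⟩ : ∃ w, w = k * y * k⁻¹ * y⁻¹ := ⟨_, rfl⟩
  have hwN : w ∈ commutator G := by
    rw [← hy, hw]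
    exact mul_mem hmem (inv_mem (mem_zpowers y))
  have hw1 : w ≠ 1 := by
    intro h
    rw [hw, mul_inv_eq_one, mul_inv_eq_iff_eq_mul] at h
    exact hyk h.symm
  have hwinv : k * w * k⁻¹ = w⁻¹ := by
    rw [hw]
    calc k * (k * y * k⁻¹ * y⁻¹) * k⁻¹ = (k * k * y) * (k⁻¹ * y⁻¹ * k⁻¹) := by group
      _ = (k * y * k⁻¹ * y⁻¹)⁻¹ := by rw [hkk]; group
  by_cases hodd : ∃ p : ℕ, p.Prime ∧ Odd p ∧ p ∣ orderOf w
  · obtain ⟨p, hp, hpo, d, hd⟩ := hodd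
    have hd0 : d ≠ 0 := by
      rintro rfl
      exact (orderOf_pos w).ne' (by simpa using hd)
    refine final_semi hcyc p hp hpo (w ^ d) k ?_ ?_
    · rw [orderOf_pow_of_dvd hd0 (hd ▸ Dvd.intro_left _ rfl), hd,
        Nat.mul_div_cancel _ (Nat.pos_of_ne_zero hd0)]
    · rw [← conj_pow, hwinv, inv_pow]
  · exfalso
    push Not at hodd
    have h1 : orderOf w ≠ 1 := by rwa [Ne, orderOf_eq_one_iff]
    obtain ⟨p, hp, hpd⟩ := Nat.exists_prime_and_dvd h1
    have hp2 : p = 2 := by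
      rcases hp.eq_two_or_odd' with h | h
      · exact h
      · exact absurd hpd (hodd p hp h)
    subst hp2
    have h2 : 2 ∣ Nat.card (commutator G) :=
      hpd.trans (Subgroup.orderOf_dvd_natCard _ hwN)
    have h3 := (IsZGroup.coprime_commutator_index G).coprime_dvd_left h2
    have h4 : Odd (commutator G).index := Nat.coprime_two_left.mp h3
    obtain ⟨r, hr⟩ := h4
    have h5 : k ^ (commutator G).index ∈ commutator G := Subgroup.pow_index_mem _ k
    rw [← hy] at h5
    obtain ⟨j, hj⟩ := h5
    have h6 : Commute (k ^ (2 * r + 1)) y := by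
      rw [hy, hr] at hj
      change y ^ j = _ at hj
      rw [← hj]
      exact (Commute.refl y).zpow_left j
    have h7 : Commute (k ^ (2 * r)) y := by
      rw [pow_mul, pow_two]
      exact Commute.pow_left hkk r
    rw [pow_succ'] at h6
    have h8 : Commute (k * k ^ (2 * r) * (k ^ (2 * r))⁻¹) y := h6.mul_left h7.inv_left
    rw [mul_inv_cancel_right] at h8
    exact hyk h8.symm.eq

lemma max_sub [Finite G] {p n : ℕ} [hp : Fact p.Prime] (hcard : Nat.card G = p ^ (n + 1))
    (H : Subgroup G) (hH : H ≠ ⊤) :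
    ∃ M : Subgroup G, H ≤ M ∧ M ≠ ⊤ ∧ M.index = p ∧ M.Normal := by
  obtain ⟨l, hl⟩ := ((IsPGroup.of_card hcard).to_subgroup H).exists_card_eq
  have hln : l ≤ n := by
    by_contra! h
    apply hH
    apply Subgroup.eq_top_of_le_card
    rw [hcard, hl]
    exact Nat.pow_le_pow_right hp.out.pos h
  obtain ⟨M, hM, hHM⟩ := Sylow.exists_subgroup_card_pow_prime_le (n := l) (m := n) p
    (by rw [hcard]; exact pow_dvd_pow _ (Nat.le_succ n)) H hl hln
  have hidx : M.index = p := by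
    have := M.card_mul_index
    rw [hM, hcard, pow_succ] at this
    exact Nat.eq_of_mul_eq_mul_left (pow_pos hp.out.pos n) this
  refine ⟨M, hHM, ?_, hidx, ?_⟩
  · rintro rfl
    rw [Subgroup.index_top] at hidx
    exact hp.out.one_lt.ne hidx
  · apply Subgroup.normal_of_index_eq_minFac_card
    rw [hidx, hcard, hp.out.pow_minFac (Nat.succ_ne_zero n)]

lemma case_2 [Finite G] (hna : ¬ ∀ a b : G, a * b = b * a)
    (hcyc : ∀ H : Subgroup G, H ≠ ⊤ → IsCyclic H) (n : ℕ) (hcard : Nat.card G = 2 ^ (n + 1))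
    (y g : G) (hyi : (zpowers y).index = 2) (hgi : (zpowers g).index = 2) (hyg : y * g ≠ g * y) :
    Nonempty (G ≃* QuaternionGroup 2) := by
  have hyn := Subgroup.normal_of_index_eq_two hyi
  have hgn := Subgroup.normal_of_index_eq_two hgi
  have comm_y : ∀ x ∈ zpowers y, Commute x y := by
    rintro _ ⟨j, rfl⟩; exact (Commute.refl y).zpow_left j
  have comm_g : ∀ x ∈ zpowers g, Commute x g := by
    rintro _ ⟨j, rfl⟩; exact (Commute.refl g).zpow_left j
  have hy2 : y * y ∈ zpowers g := Subgroup.mul_self_mem_of_index_two hgi y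
  have hg2 : g * g ∈ zpowers y := Subgroup.mul_self_mem_of_index_two hyi g
  have hD : ∀ h ∈ zpowers g, ∃ d ∈ zpowers g, d = y * h * y⁻¹ * h⁻¹ ∧ Commute d y ∧ d * d = 1 := by
    intro h hh
    have hd1 : y * h * y⁻¹ * h⁻¹ ∈ zpowers g := mul_mem (hgn.conj_mem h hh y) (inv_mem hh)
    have hd2 : y * h * y⁻¹ * h⁻¹ ∈ zpowers y := by
      have := mul_mem (mem_zpowers y) (hyn.conj_mem y⁻¹ (inv_mem (mem_zpowers y)) h)
      simpa [mul_assoc] using this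
    refine ⟨_, hd1, rfl, comm_y _ hd2, ?_⟩
    have h1 : y * y * h = h * (y * y) := by
      obtain ⟨i, hi⟩ := hy2
      obtain ⟨j, hj⟩ := hh
      change g ^ i = _ at hi
      change g ^ j = _ at hj
      rw [← hi, ← hj]
      exact ((Commute.refl g).zpow_zpow i j).eq
    obtain ⟨d, hd⟩ : ∃ d, d = y * h * y⁻¹ * h⁻¹ := ⟨_, rfl⟩
    have hdy : d * y = y * d := hd ▸ (comm_y _ hd2).eq
    rw [← hd]
    have h2 : d * h * y = y * h := by rw [hd]; group
    have h3 : d * d * h * (y * y) = h * (y * y) := by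
      calc d * d * h * (y * y) = d * (d * h * y) * y := by group
        _ = (d * y) * h * y := by rw [h2]; group
        _ = y * (d * h * y) := by rw [hdy]; group
        _ = h * (y * y) := by rw [h2, ← mul_assoc, h1]
    have h4 : d * d * (h * (y * y)) = h * (y * y) := by rw [← mul_assoc]; exact h3
    exact mul_eq_right.mp h4
  obtain ⟨h, hh, hhy, hhh⟩ : ∃ h ∈ zpowers g, y * h ≠ h * y ∧ y * y = h * h := by
    obtain ⟨a, ha⟩ := hy2
    change g ^ a = y * y at ha
    rcases Int.even_or_odd a with ⟨j, rfl⟩ | ⟨j, rfl⟩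
    · refine ⟨g ^ j, zpow_mem (mem_zpowers g) j, ?_, by rw [← ha, zpow_add]⟩
      intro hc
      obtain ⟨c, hcg, hc0, hcy, hcc⟩ := hD g (mem_zpowers g)
      have hc1 : c ≠ 1 := by
        intro h
        rw [h, eq_comm, mul_inv_eq_one, mul_inv_eq_iff_eq_mul] at hc0
        exact hyg hc0
      have hcom : Commute y (g ^ j) := hc
      have hmemy : y * (g ^ j)⁻¹ ∈ zpowers g := by
        rcases unique_inv hna hcyc (y * (g ^ j)⁻¹) c
          (Commute.mul_left hcy.symm ((comm_g c hcg).symm.zpow_left j).inv_left).eq (by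
            calc y * (g ^ j)⁻¹ * (y * (g ^ j)⁻¹) = y * ((g ^ j)⁻¹ * y) * (g ^ j)⁻¹ := by group
              _ = (y * y) * ((g ^ j)⁻¹ * (g ^ j)⁻¹) := by
                rw [← (hcom.inv_right).eq]; group
              _ = 1 := by rw [← ha]; group) hcc hc1 with h | h
        · rw [h]; exact one_mem _
        · rw [h]; exact hcg
      have : y ∈ zpowers g := by
        have := mul_mem hmemy (zpow_mem (mem_zpowers g) j)
        rwa [inv_mul_cancel_right] at this
      exact hyg (comm_g y this).eq
    · exfalso
      have h1 : Commute (g ^ (2 * j)) y := by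
        rw [zpow_mul, show g ^ (2 : ℤ) = g * g from by rw [zpow_two]]
        exact (comm_y _ hg2).zpow_left j
      have h2 : Commute (g ^ (2 * j + 1)) y := by
        rw [ha]
        exact (Commute.refl y).mul_left (Commute.refl y)
      have h3 := h1.inv_left.mul_left h2
      rw [zpow_add, inv_mul_cancel_left, zpow_one] at h3
      exact hyg h3.symm.eq
  obtain ⟨d, hdg, hd, hdy, hdd⟩ := hD h hh
  have hd1 : d ≠ 1 := by
    intro h
    rw [h, eq_comm, mul_inv_eq_one, mul_inv_eq_iff_eq_mul] at hd
    exact hhy hd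
  have hdh : Commute d h := by
    obtain ⟨j, hj⟩ := hh
    rw [← hj]
    exact (comm_g d hdg).zpow_right j
  have hdinv : d⁻¹ = d := inv_eq_of_mul_eq_one_left hdd
  obtain ⟨t, ht⟩ : ∃ t, t = y * h⁻¹ := ⟨_, rfl⟩
  have hyh : y * h = d * h * y := by rw [hd]; group
  have hdt : Commute d t := by rw [ht]; exact hdy.mul_right hdh.inv_right
  have hyt : y * t = d * t * y := by
    have h1 : y * h⁻¹ = d * h⁻¹ * y := by
      have h2 : h⁻¹ * (y * h) * h⁻¹ = h⁻¹ * (d * h * y) * h⁻¹ := by rw [hyh]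
      have h3 : h⁻¹ * (d * h * y) * h⁻¹ = d * (y * h⁻¹) := by
        rw [show d * h = h * d from hdh]; group
      rw [h3] at h2
      have h4 : h⁻¹ * (y * h) * h⁻¹ = h⁻¹ * y := by group
      rw [h4] at h2
      rw [mul_assoc, h2, ← mul_assoc, hdd, one_mul]
    rw [ht]
    calc y * (y * h⁻¹) = y * (d * h⁻¹ * y) := by rw [h1]
      _ = (y * d) * h⁻¹ * y := by group
      _ = d * (y * h⁻¹) * y := by rw [← hdy.eq]; group
  have htt : t * t = d := by
    have h1 : t * y = d * y * t := by
      rw [mul_assoc, hyt, ← mul_assoc, ← mul_assoc, hdd, one_mul]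
    calc t * t = (t * y) * h⁻¹ := by nth_rewrite 2 [ht]; group
      _ = d * y * (y * h⁻¹) * h⁻¹ := by rw [h1, ht]
      _ = d * (y * y) * (h⁻¹ * h⁻¹) := by group
      _ = d := by rw [hhh]; group
  have hytne : y * t ≠ t * y := by
    intro h
    rw [hyt, mul_assoc] at h
    exact hd1 (mul_eq_right.mp h)
  have hy2t : Commute (y * y) t := by
    have h1 : Commute (y * y) h := by rw [hhh]; exact (Commute.refl h).mul_left (Commute.refl h)
    rw [ht]
    exact ((Commute.refl y).mul_left (Commute.refl y)).mul_right h1.inv_right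
  have hyy1 : y * y ≠ 1 := by
    intro h
    rcases unique_inv hna hcyc y d hdy.symm.eq h hdd hd1 with h | h
    · rw [h] at hytne; simp at hytne
    · rw [h] at hytne; exact hytne hdt.eq
  have hcy : orderOf y = 2 ^ n := by
    have := (zpowers y).card_mul_index
    rw [hyi, hcard, Nat.card_zpowers, pow_succ] at this
    omega
  have hn2 : n = 2 := by
    rcases Nat.lt_or_ge n 2 with hlt | hge
    · exfalso
      apply hyy1
      rw [← pow_two]
      apply orderOf_dvd_iff_pow_eq_one.mp
      rw [hcy]
      calc 2 ^ n ∣ 2 ^ 1 := pow_dvd_pow 2 (by omega)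
        _ = 2 := by norm_num
    rcases hge.eq_or_lt with h | hlt
    · exact h.symm
    exfalso
    obtain ⟨l, rfl⟩ := Nat.exists_eq_add_of_lt hlt
    obtain ⟨s, hs⟩ : ∃ s, s = y ^ (2 ^ (l + 1)) := ⟨_, rfl⟩
    have hss : s * s = y ^ (2 ^ (l + 2)) := by
      rw [hs, ← pow_add]; congr 1; ring
    have hss1 : s * s ≠ 1 := by
      rw [hss]
      intro h
      have := Nat.le_of_dvd (by positivity) (orderOf_dvd_of_pow_eq_one h)
      rw [hcy] at this
      have := (Nat.pow_le_pow_iff_right (by norm_num)).mp this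
      omega
    have hssss : (s * s) * (s * s) = 1 := by
      rw [hss, ← pow_add]
      have : 2 ^ (l + 2) + 2 ^ (l + 2) = orderOf y := by rw [hcy]; ring
      rw [this, pow_orderOf_eq_one]
    have hsd : Commute s d := by rw [hs]; exact hdy.symm.pow_left _
    have hst : Commute s t := by
      rw [hs, pow_succ', pow_mul, pow_two]
      exact hy2t.pow_left _
    have hsy : Commute s y := by rw [hs]; exact (Commute.refl y).pow_left _
    have hsseq : s * s = d := by
      rcases unique_inv hna hcyc (s * s) d (hsd.mul_left hsd).eq hssss hdd hd1 with h | h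
      · exact absurd h hss1
      · exact h
    have h1 : t * s * (t * s) = 1 := by
      calc t * s * (t * s) = t * (s * t) * s := by group
        _ = (t * t) * (s * s) := by rw [hst.eq]; group
        _ = 1 := by rw [htt, hsseq, hdd]
    have h2 : Commute (t * s) y := by
      rcases unique_inv hna hcyc (t * s) d (hdt.symm.mul_left hsd).eq h1 hdd hd1 with h | h
      · rw [h]; exact Commute.one_left y
      · rw [h]; exact hdy
    have h3 := h2.mul_left hsy.inv_left
    rw [mul_inv_cancel_right] at h3
    exact hytne h3.symm.eq
  subst hn2
  have hy4 : y ^ 4 = 1 := by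
    have := pow_orderOf_eq_one y
    rwa [hcy] at this
  have hyyd : y * y = d := by
    rcases unique_inv hna hcyc (y * y) d (hdy.symm.mul_left hdy.symm).eq
      (by rw [← hy4, ← pow_two, ← pow_two, ← pow_mul]) hdd hd1 with h | h
    · exact absurd h hyy1
    · exact h
  refine q8_iso y t hy4 (htt.trans hyyd.symm) ?_ (closure_top hcyc y t hytne) hcard
  rw [hyt, hdt.eq, mul_assoc]
  congr 1
  rw [eq_inv_iff_mul_eq_one, mul_assoc, hyyd, hdd]

lemma case_p [Finite G] (hna : ¬ ∀ a b : G, a * b = b * a)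
    (hcyc : ∀ H : Subgroup G, H ≠ ⊤ → IsCyclic H)
    (hsq : ∀ y k : G, k * y * k⁻¹ ∈ zpowers y → k * k * y = y * (k * k))
    (p : ℕ) [hp : Fact p.Prime] (hG : IsPGroup p G) :
    Nonempty (G ≃* QuaternionGroup 2) := by
  obtain ⟨n, hn⟩ := hG.exists_card_eq
  have hbot : (⊥ : Subgroup G) ≠ ⊤ := by
    intro h
    apply hna
    intro a b
    have h1 : a ∈ (⊥ : Subgroup G) := h ▸ mem_top a
    have h2 : a = 1 := Subgroup.mem_bot.mp h1
    rw [h2]; simp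
  have hzp : ∀ x : G, zpowers x ≠ ⊤ := by
    intro x h
    apply hna
    intro a b
    obtain ⟨i, rfl⟩ : a ∈ zpowers x := h ▸ mem_top a
    obtain ⟨j, rfl⟩ : b ∈ zpowers x := h ▸ mem_top b
    exact ((Commute.refl x).zpow_zpow i j).eq
  obtain ⟨n, rfl⟩ : ∃ m, n = m + 1 := by
    apply Nat.exists_eq_succ_of_ne_zero
    rintro rfl
    apply hbot
    apply Subgroup.eq_top_of_le_card
    rw [hn]; simp
  obtain ⟨N, -, hNt, hNi, hNn⟩ := max_sub hn ⊥ hbot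
  have hNc := hcyc N hNt
  rw [Subgroup.isCyclic_iff_exists_zpowers_eq_top] at hNc
  obtain ⟨y, rfl⟩ := hNc
  obtain ⟨g, hg⟩ : ∃ g, g ∉ zpowers y := by
    by_contra! h
    exact hNt (eq_top_iff.mpr fun x _ => h x)
  have hgen : closure {y, g} = ⊤ := by
    have hle : zpowers y ≤ closure {y, g} := by
      rw [zpowers_le]; exact subset_closure (by simp)
    have h1 : (closure {y, g}).index ∣ p := hNi ▸ Subgroup.index_dvd_of_le hle
    rcases (Nat.dvd_prime hp.out).mp h1 with h | h
    · exact Subgroup.index_eq_one.mp h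
    · exfalso
      apply hg
      have h2 : zpowers y = closure {y, g} := by
        apply Subgroup.eq_of_le_of_card_ge hle
        have h3 := (zpowers y).card_mul_index
        have h4 := (closure {y, g}).card_mul_index
        rw [hNi] at h3
        rw [h, ← h3] at h4
        exact (Nat.eq_of_mul_eq_mul_right hp.out.pos h4).le
      rw [h2]; exact subset_closure (by simp)
  have hyg : y * g ≠ g * y := fun h => hna (comm_of_gen y g h hgen)
  have hgg := hsq y g (hNn.conj_mem y (mem_zpowers y) g)
  have hp2 : p = 2 := by
    rcases hp.out.eq_two_or_odd' with h | h
    · exact h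
    exfalso
    obtain ⟨l, hl⟩ := (IsPGroup.iff_orderOf.mp hG) g
    have ho : Odd (orderOf g) := hl ▸ h.pow
    obtain ⟨r, hr⟩ := ho
    have h1 : g = (g * g) ^ (r + 1) := by
      have : g ^ (2 * r + 1) = 1 := by rw [← hr, pow_orderOf_eq_one]
      rw [← pow_two, ← pow_mul, show 2 * (r + 1) = 2 * r + 1 + 1 from by ring, pow_succ, this,
        one_mul]
    have h2 : Commute ((g * g) ^ (r + 1)) y := Commute.pow_left hgg _
    rw [← h1] at h2
    exact hyg h2.symm.eq
  subst hp2
  obtain ⟨M, hgM, hMt, hMi, -⟩ := max_sub hn (zpowers g) (hzp g)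
  have hMc := hcyc M hMt
  rw [Subgroup.isCyclic_iff_exists_zpowers_eq_top] at hMc
  obtain ⟨g', rfl⟩ := hMc
  refine case_2 hna hcyc n hn y g' hNi hMi ?_
  intro hc
  obtain ⟨j, hj⟩ := hgM (mem_zpowers g)
  apply hyg
  rw [← hj]
  exact (Commute.zpow_right hc j).eq

lemma main_aux [Finite G] (hna : ¬ ∀ a b : G, a * b = b * a)
    (hcyc : ∀ H : Subgroup G, H ≠ ⊤ → IsCyclic H)
    (hsq : ∀ y k : G, k * y * k⁻¹ ∈ zpowers y → k * k * y = y * (k * k)) :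
    Nonempty (G ≃* QuaternionGroup 2) ∨
    ∃ p m : ℕ, p.Prime ∧ Odd p ∧ 1 ≤ m ∧
      ∃ φ : Multiplicative (ZMod (2 ^ m)) →* MulAut (Multiplicative (ZMod p)),
        (∀ g : Multiplicative (ZMod p), φ (Multiplicative.ofAdd 1) g = g⁻¹) ∧
        Nonempty (G ≃* (Multiplicative (ZMod p) ⋊[φ] Multiplicative (ZMod (2 ^ m)))) := by
  by_cases h : ∃ p : ℕ, p.Prime ∧ IsPGroup p G
  · obtain ⟨p, hp, hG⟩ := h
    have := Fact.mk hp
    exact Or.inl (case_p hna hcyc hsq p hG)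
  · right
    have : IsZGroup G := by
      refine ⟨fun p hp P => hcyc _ fun htop => h ⟨p, hp, ?_⟩⟩
      have h1 := P.2
      rw [htop] at h1
      exact h1.of_equiv Subgroup.topEquiv
    exact case_z hna hcyc hsq

end


theorem stmt_2 (G : Type*) [Group G] [Finite G]
    (hna : ¬ ∀ a b : G, a * b = b * a) (h : MinFaithful G 2) :
    Nonempty (G ≃* QuaternionGroup 2) ∨
    ∃ p m : ℕ, p.Prime ∧ Odd p ∧ 1 ≤ m ∧
      ∃ φ : Multiplicative (ZMod (2 ^ m)) →* MulAut (Multiplicative (ZMod p)),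
        (∀ g : Multiplicative (ZMod p), φ (Multiplicative.ofAdd 1) g = g⁻¹) ∧
        Nonempty (G ≃* (Multiplicative (ZMod p) ⋊[φ] Multiplicative (ZMod (2 ^ m)))) := by
  obtain ⟨ρ, hρ⟩ := get_rep h
  exact main_aux hna (get_cyc h) (rep_key ρ hρ)
end

section
/- Let G be a finite nonabelian group. If G has odd order, or if the center Z(G) is not cyclic, then rdim(G) ≥ 3. -/
open Matrix in
/-- A 2×2 matrix commuting with two noncommuting matrices is scalar. -/
lemma scalar_of_comm (A B Z : Matrix (Fin 2) (Fin 2) ℂ) (hAB : A * B ≠ B * A)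
    (hA : Z * A = A * Z) (hB : Z * B = B * Z) :
    Z 0 1 = 0 ∧ Z 1 0 = 0 ∧ Z 0 0 = Z 1 1 := by
  by_contra hcon
  apply hAB
  have a := fun i j => congrFun (congrFun hA i) j
  have b := fun i j => congrFun (congrFun hB i) j
  simp only [Matrix.mul_apply, Fin.sum_univ_two] at a b
  have a00 := a 0 0
  have a01 := a 0 1
  have a10 := a 1 0
  have b00 := b 0 0
  have b01 := b 0 1
  have b10 := b 1 0
  -- the vectors (x01, x10, x00 - x11) of A and B are proportional to that of Z
  have key : A 0 1 * B 1 0 = B 0 1 * A 1 0 ∧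
      A 0 1 * (B 0 0 - B 1 1) = B 0 1 * (A 0 0 - A 1 1) ∧
      A 1 0 * (B 0 0 - B 1 1) = B 1 0 * (A 0 0 - A 1 1) := by
    generalize A 0 0 = p0, A 0 1 = p1, A 1 0 = p2, A 1 1 = p3 at *
    generalize B 0 0 = q0, B 0 1 = q1, B 1 0 = q2, B 1 1 = q3 at *
    generalize Z 0 0 = z0, Z 0 1 = z1, Z 1 0 = z2, Z 1 1 = z3 at *
    by_cases h1 : z1 = 0
    · by_cases h2 : z2 = 0
      · have h3 : z0 - z3 ≠ 0 := fun h => hcon ⟨h1, h2, sub_eq_zero.mp h⟩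
        refine ⟨?_, ?_, ?_⟩ <;> apply mul_left_cancel₀ h3 <;> grind
      · refine ⟨?_, ?_, ?_⟩ <;> apply mul_left_cancel₀ h2 <;> grind
    · refine ⟨?_, ?_, ?_⟩ <;> apply mul_left_cancel₀ h1 <;> grind
  obtain ⟨k1, k2, k3⟩ := key
  ext i j
  fin_cases i <;> fin_cases j <;> simp [Matrix.mul_apply, Fin.sum_univ_two] <;> grind

lemma isIntegral_trace_of_pow (A : Matrix (Fin 2) (Fin 2) ℂ) (n : ℕ) (hn : n ≠ 0)
    (h : A ^ n = 1) : IsIntegral ℤ A.trace := by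
  rw [Matrix.trace_eq_sum_roots_charpoly]
  apply Subring.multiset_sum_mem (integralClosure ℤ ℂ).toSubring
  intro μ hμ
  have h1 : μ ∈ spectrum ℂ A := by
    rw [Matrix.mem_spectrum_iff_isRoot_charpoly]
    exact (Polynomial.mem_roots'.mp hμ).2
  have h2 : μ ^ n ∈ spectrum ℂ (A ^ n) := spectrum.pow_mem_pow A n h1
  rw [h, spectrum.one_eq] at h2
  have h3 : μ ^ n = 1 := h2
  show IsIntegral ℤ μ
  exact IsIntegral.of_pow (Nat.pos_of_ne_zero hn) (h3 ▸ isIntegral_one)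

lemma exists_faithful (G : Type*) [Group G] [Finite G] :
    ∃ n, ∃ ρ : G →* GL (Fin n) ℂ, Function.Injective ρ := by
  classical
  let e := Finite.equivFin G
  let f : G →* Matrix (Fin (Nat.card G)) (Fin (Nat.card G)) ℂ :=
    { toFun := fun g => Matrix.of fun i j => if e.symm i = g * e.symm j then 1 else 0
      map_one' := by
        ext i j
        simp [Matrix.one_apply]
      map_mul' := by
        intro a b
        ext i j
        rw [Matrix.mul_apply, Finset.sum_eq_single (e (b * e.symm j))]
        · simp [mul_assoc]
        · intro k _ hk
          have : e.symm k ≠ b * e.symm j := fun h => hk (by rw [← h]; simp)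
          simp [this]
        · simp }
  refine ⟨_, f.toHomUnits, fun a b hab => ?_⟩
  have h1 : f a = f b := congrArg Units.val hab
  have h2 := congrFun (congrFun h1 (e a)) (e 1)
  by_contra hne
  simp [f, hne] at h2

lemma half_not_integral (x : ℂ) (hx : IsIntegral ℤ x) (h : 1 = 2 * x) : False := by
  have hx' : x = algebraMap ℚ ℂ (1/2) := by
    simp only [map_div₀, map_one, map_ofNat]; linear_combination -h/2
  rw [hx', isIntegral_algebraMap_iff (algebraMap ℚ ℂ).injective,
    IsIntegrallyClosed.isIntegral_iff] at hx
  obtain ⟨y, hy⟩ := hx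
  have : (2 * y : ℚ) = 1 := by simp at hy; rw [hy]; norm_num
  have h3 : 2 * y = 1 := by exact_mod_cast this
  omega

lemma sum_parity (G : Type*) [Group G] [Fintype G] (hodd : Odd (Nat.card G))
    (f : G → ℂ) (hf : ∀ g, IsIntegral ℤ (f g)) (hinv : ∀ g, f g⁻¹ = f g)
    (h1 : f 1 = 4) (hs : ∑ g, f g = Nat.card G) : False := by
  classical
  let R := integralClosure ℤ ℂ
  let F : G → R := fun g => ⟨f g, hf g⟩
  let I : Ideal R := Ideal.span {2}
  let q := Ideal.Quotient.mk I
  have q2 : q 2 = 0 := Ideal.Quotient.eq_zero_iff_mem.mpr (Ideal.subset_span rfl)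
  have hF : ∑ g, F g = (Nat.card G : R) := by
    apply Subtype.ext
    push_cast
    simpa [F] using hs
  have hF1 : F 1 = 4 := Subtype.ext h1
  have hsum : ∑ g ∈ Finset.univ.erase (1 : G), q (F g) = 0 := by
    apply Finset.sum_involution (fun g _ => g⁻¹)
    · intro g _
      have : F g⁻¹ = F g := Subtype.ext (hinv g)
      rw [this, ← map_add, ← two_mul, map_mul, q2, zero_mul]
    · intro g hg _ hgg
      have hg1 : g ≠ 1 := (Finset.mem_erase.mp hg).1
      apply hg1
      have hsq : g ^ 2 = 1 := by rw [pow_two]; nth_rw 1 [← hgg]; simp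
      have hd : orderOf g ∣ 2 := orderOf_dvd_of_pow_eq_one hsq
      have hc : orderOf g ∣ Nat.card G := orderOf_dvd_natCard g
      have := Nat.dvd_gcd hd hc
      rw [(Nat.coprime_two_left.mpr hodd).gcd_eq_one] at this
      exact orderOf_eq_one_iff.mp (Nat.dvd_one.mp this)
    · intro g _
      simp
    · intro g hg
      simpa using hg
  have htot : q (Nat.card G : R) = 0 := by
    rw [← hF, map_sum, ← Finset.add_sum_erase _ _ (Finset.mem_univ (1 : G)), hsum, hF1,
      show (4 : R) = 2 * 2 by norm_num, map_mul, q2]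
    simp
  obtain ⟨m, hm⟩ := hodd
  rw [hm] at htot
  push_cast at htot
  rw [map_add, map_mul, q2, zero_mul, zero_add] at htot
  rw [Ideal.Quotient.eq_zero_iff_mem, Ideal.mem_span_singleton] at htot
  obtain ⟨x, hx⟩ := htot
  exact half_not_integral x.1 x.2 (congrArg Subtype.val hx)

lemma sum_char (G : Type*) [Group G] [Fintype G] (ρ : G →* Matrix (Fin 2) (Fin 2) ℂ)
    (a b : G) (hab : ρ a * ρ b ≠ ρ b * ρ a) :
    ∑ g, (ρ g).trace * (ρ g⁻¹).trace = Nat.card G := by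
  let T : Matrix (Fin 2) (Fin 2) ℂ → Matrix (Fin 2) (Fin 2) ℂ :=
    fun X => ∑ g, ρ g * X * ρ g⁻¹
  have hT : ∀ X (c : G), T X * ρ c = ρ c * T X := by
    intro X c
    simp only [T, Finset.sum_mul, Finset.mul_sum]
    refine Fintype.sum_equiv (Equiv.mulLeft c⁻¹) _ _ fun g => ?_
    simp only [Equiv.coe_mulLeft, mul_inv_rev, inv_inv, mul_assoc, ← map_mul]
    simp only [← mul_assoc, ← map_mul]
    simp
  have htr : ∀ X, (T X).trace = Nat.card G * X.trace := by
    intro X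
    simp only [T, Matrix.trace_sum]
    have : ∀ g, (ρ g * X * ρ g⁻¹).trace = X.trace := by
      intro g
      rw [Matrix.trace_mul_comm, ← mul_assoc, ← map_mul]
      simp
    simp [this]
  have hsc := fun X => scalar_of_comm (ρ a) (ρ b) (T X) hab (hT X a) (hT X b)
  have hexp : ∑ g, (ρ g).trace * (ρ g⁻¹).trace =
      ∑ i, ∑ j, T (Matrix.single i j 1) i j := by
    simp only [T, Matrix.sum_apply, Fin.sum_univ_two, ← Finset.sum_add_distrib]
    refine Finset.sum_congr rfl fun g _ => ?_
    simp [Matrix.mul_apply, Matrix.trace, Matrix.single_apply, Fin.sum_univ_two]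
    ring
  rw [hexp]
  simp only [Fin.sum_univ_two]
  have t0 := htr (Matrix.single 0 0 1)
  have t1 := htr (Matrix.single 1 1 1)
  simp only [Matrix.trace_fin_two, Matrix.single_apply] at t0 t1
  simp at t0 t1
  have s0 := hsc (Matrix.single 0 0 1)
  have s1 := hsc (Matrix.single 1 1 1)
  rw [(hsc (Matrix.single 0 1 1)).1, (hsc (Matrix.single 1 0 1)).2.1]
  simp only [Nat.card_eq_fintype_card]
  linear_combination t0 / 2 + t1 / 2 + s0.2.2 / 2 - s1.2.2 / 2

lemma not_dim_two (G : Type*) [Group G] [Finite G]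
    (hna : ¬ ∀ a b : G, a * b = b * a)
    (h : Odd (Nat.card G) ∨ ¬ IsCyclic (Subgroup.center G))
    (ρ' : G →* GL (Fin 2) ℂ) (hinj' : Function.Injective ρ') : False := by
  have := Fintype.ofFinite G
  let ρ : G →* Matrix (Fin 2) (Fin 2) ℂ := (Units.coeHom _).comp ρ'
  have hinj : Function.Injective ρ := fun x y hxy => hinj' (Units.ext hxy)
  push Not at hna
  obtain ⟨a, b, hab⟩ := hna
  have hab' : ρ a * ρ b ≠ ρ b * ρ a := by
    rw [← map_mul, ← map_mul]; exact fun h => hab (hinj h)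
  rcases h with hodd | hc
  · have htrace : ∀ g, IsIntegral ℤ (ρ g).trace := fun g =>
      isIntegral_trace_of_pow _ (Nat.card G) Nat.card_pos.ne'
        (by rw [← map_pow, pow_card_eq_one', map_one])
    refine sum_parity G hodd (fun g => (ρ g).trace * (ρ g⁻¹).trace)
      (fun g => (htrace g).mul (htrace _)) (fun g => ?_) ?_ (sum_char G ρ a b hab')
    · simp [mul_comm]
    · simp; norm_num
  · apply hc
    have hz : ∀ z : Subgroup.center G, (ρ z) 0 1 = 0 ∧ (ρ z) 1 0 = 0 ∧ (ρ z) 0 0 = (ρ z) 1 1 := by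
      intro z
      have hzc := fun g => Subgroup.mem_center_iff.mp z.2 g
      apply scalar_of_comm _ _ _ hab' <;> rw [← map_mul, ← map_mul, hzc]
    let f : Subgroup.center G →* ℂ :=
      { toFun := fun z => ρ z 0 0
        map_one' := by simp
        map_mul' := by
          intro x y
          simp [Matrix.mul_apply, Fin.sum_univ_two, (hz x).1] }
    refine isCyclic_of_injective_ringHom f fun x y hxy => ?_
    have hxy' : ρ x 0 0 = ρ y 0 0 := hxy
    apply Subtype.ext
    apply hinj
    have hx := hz x
    have hy := hz y
    ext i j
    fin_cases i <;> fin_cases j <;> simp <;> grind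

theorem stmt_3 (G : Type*) [Group G] [Finite G]
    (hna : ¬ ∀ a b : G, a * b = b * a)
    (h : Odd (Nat.card G) ∨ ¬ IsCyclic (Subgroup.center G)) :
    3 ≤ rdim G := by
  have hne : {n : ℕ | ∃ ρ : G →* GL (Fin n) ℂ, Function.Injective ρ}.Nonempty :=
    exists_faithful G
  obtain ⟨ρ, hρ⟩ := Nat.sInf_mem hne
  by_contra hlt
  have hlt' : sInf {n : ℕ | ∃ ρ : G →* GL (Fin n) ℂ, Function.Injective ρ} < 3 := by
    simpa [rdim] using hlt
  revert ρ
  generalize sInf {n : ℕ | ∃ ρ : G →* GL (Fin n) ℂ, Function.Injective ρ} = n at hlt'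
  intro ρ hρ
  interval_cases n
  · exact hna fun a b => hρ (Subsingleton.elim _ _)
  · refine hna fun a b => hρ ?_
    rw [map_mul, map_mul]
    apply Units.ext
    ext i j
    fin_cases i; fin_cases j
    simp [Matrix.mul_apply, mul_comm]
  · exact not_dim_two G hna h ρ hρ
end

section
/- Let G be a finite nonabelian group of odd order with rdim(G) = 3. Then 3 divides the order of G and the center Z(G) is cyclic. -/
open Module in
/-- If the commutant of a `d`-dimensional matrix representation is scalar, `d ∣ |G|`. -/
theorem dvd_card_of_scalar_commutant {G : Type*} [Group G] [Fintype G] (d : ℕ) (hd : 0 < d)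
    (r : G →* Matrix (Fin d) (Fin d) ℂ)
    (hS : ∀ M, (∀ g, r g * M = M * r g) → ∃ c : ℂ, M = c • 1) :
    d ∣ Fintype.card G := by
  have hd0 : (d : ℂ) ≠ 0 := by exact_mod_cast hd.ne'
  have hinv : ∀ a, r a⁻¹ * r a = 1 := fun a => by rw [← map_mul]; simp
  have h1 : ∀ X : Matrix (Fin d) (Fin d) ℂ,
      ∑ a, r a * X * r a⁻¹ = ((Fintype.card G / d : ℂ) * X.trace) • 1 := by
    intro X
    obtain ⟨c, hc⟩ := hS (∑ a, r a * X * r a⁻¹) (by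
      intro g
      rw [Finset.mul_sum, Finset.sum_mul]
      refine Fintype.sum_equiv (Equiv.mulLeft g) _ _ ?_
      intro a
      simp only [Equiv.coe_mulLeft, mul_inv_rev, map_mul]
      simp only [mul_assoc, hinv, mul_one])
    have ht := congrArg Matrix.trace hc
    rw [Matrix.trace_sum] at ht
    have : ∀ a, (r a * X * r a⁻¹).trace = X.trace := by
      intro a
      rw [Matrix.trace_mul_comm, ← mul_assoc, hinv, one_mul]
    simp only [this, Finset.sum_const, Finset.card_univ, Matrix.trace_smul, Matrix.trace_one,
      Fintype.card_fin, nsmul_eq_mul, smul_eq_mul] at ht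
    rw [hc]
    congr 1
    field_simp
    linear_combination -ht
  have h2 : ∑ b, (r b).trace • r b⁻¹ = (Fintype.card G / d : ℂ) • 1 := by
    ext k l
    have h3 : ∀ i, ∑ b, r b i i * r b⁻¹ k l
        = (Fintype.card G / d : ℂ) * ((if i = k then 1 else 0) * (if i = l then 1 else 0)) := by
      intro i
      have := congrFun (congrFun (h1 (Matrix.single i k 1)) i) l
      rw [Matrix.sum_apply] at this
      have e : ∀ a, (r a * Matrix.single i k (1:ℂ) * r a⁻¹) i l = r a i i * r a⁻¹ k l := by
        intro a
        rw [Matrix.mul_apply, Finset.sum_eq_single k]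
        · simp
        · intro b _ hb
          simp [hb]
        · simp
      simp only [e] at this
      rw [this]
      by_cases hik : i = k
      · subst hik; simp [Matrix.one_apply]
      · simp [hik, Matrix.trace_single_eq_of_ne]
    rw [Matrix.sum_apply]
    simp only [Matrix.smul_apply, Matrix.trace, Matrix.diag, smul_eq_mul, Finset.sum_mul]
    rw [Finset.sum_comm]
    simp only [h3]
    rw [← Finset.mul_sum]
    simp [Matrix.one_apply, eq_comm]
  have h4 : ∑ b, ∑ a, r (a * b * a⁻¹ * b⁻¹) = ((Fintype.card G / d : ℂ) ^ 2) • 1 := by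
    have : ∀ b, ∑ a, r (a * b * a⁻¹ * b⁻¹)
        = (Fintype.card G / d : ℂ) • ((r b).trace • r b⁻¹) := by
      intro b
      simp only [map_mul]
      rw [← Finset.sum_mul, h1, smul_mul_assoc, one_mul, smul_smul]
    simp only [this]
    rw [← Finset.smul_sum, h2, smul_smul, sq]
  let φ : MonoidAlgebra ℤ G →ₐ[ℤ] Matrix (Fin d) (Fin d) ℂ := MonoidAlgebra.lift ℤ _ _ r
  have h5 : IsIntegral ℤ (∑ b, ∑ a, r (a * b * a⁻¹ * b⁻¹)) := by
    have := (IsIntegral.of_finite ℤ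
      (∑ b, ∑ a, MonoidAlgebra.of ℤ G (a * b * a⁻¹ * b⁻¹))).map φ
    simpa [φ] using this
  rw [h4, ← Algebra.algebraMap_eq_smul_one] at h5
  have : Nonempty (Fin d) := ⟨⟨0, hd⟩⟩
  rw [isIntegral_algebraMap_iff (algebraMap ℂ (Matrix (Fin d) (Fin d) ℂ)).injective] at h5
  have h6 := IsIntegral.of_pow (by norm_num : 0 < 2) h5
  have h7 : IsIntegral ℤ ((Fintype.card G : ℚ) / d) := by
    rw [← isIntegral_algebraMap_iff (algebraMap ℚ ℂ).injective]
    simpa using h6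
  obtain ⟨n, hn⟩ := IsIntegrallyClosed.isIntegral_iff.mp h7
  have hdq : (d : ℚ) ≠ 0 := by exact_mod_cast hd.ne'
  rw [eq_div_iff hdq] at hn
  have hn' : n * (d : ℤ) = (Fintype.card G : ℤ) := by
    have : (n : ℚ) * d = Fintype.card G := by simpa using hn
    exact_mod_cast this
  exact_mod_cast (Dvd.intro_left n hn' : (d : ℤ) ∣ Fintype.card G)

theorem comm_or_scalar {G : Type*} [Group G] [Fintype G] (hodd : Odd (Fintype.card G)) (n : ℕ) :
    ∀ (V : Type) [AddCommGroup V] [Module ℂ V] [FiniteDimensional ℂ V]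
      (ρ : Representation ℂ G V), Module.finrank ℂ V = n → n ≤ 3 →
      (∀ a b, ρ a * ρ b = ρ b * ρ a) ∨
      (n = 3 ∧ 3 ∣ Fintype.card G ∧
        ∀ M : Module.End ℂ V, (∀ g, ρ g * M = M * ρ g) → ∃ c : ℂ, M = c • 1) := by
  induction n using Nat.strong_induction_on with
  | _ n ih =>
  intro V _ _ _ ρ hn hn3
  by_cases hS : ∀ M : Module.End ℂ V, (∀ g, ρ g * M = M * ρ g) → ∃ c : ℂ, M = c • 1
  · rcases Nat.lt_or_ge n 2 with h2 | h2
    · left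
      -- every endomorphism is scalar
      intro a b
      let B := Module.finBasisOfFinrankEq ℂ V hn
      apply (LinearMap.toMatrixAlgEquiv B).injective
      rw [map_mul, map_mul]
      ext i j
      have hs : Subsingleton (Fin n) := Fin.subsingleton_iff_le_one.mpr (by omega)
      have : j = i := Subsingleton.elim _ _
      subst this
      rw [Matrix.mul_apply, Matrix.mul_apply]
      refine Finset.sum_congr rfl fun k _ => ?_
      have : k = j := Subsingleton.elim _ _
      subst this
      ring
    · right
      let B := Module.finBasisOfFinrankEq ℂ V hn
      let e := LinearMap.toMatrixAlgEquiv B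
      have hdvd : n ∣ Fintype.card G := by
        refine dvd_card_of_scalar_commutant n (by omega)
          ((e : Module.End ℂ V →* Matrix (Fin n) (Fin n) ℂ).comp ρ) ?_
        intro M hM
        obtain ⟨c, hc⟩ := hS (e.symm M) (by
          intro g
          apply e.injective
          simpa using hM g)
        refine ⟨c, ?_⟩
        have := congrArg e hc
        simpa using this
      have : n ≠ 2 := by
        rintro rfl
        exact (Nat.not_even_iff_odd.mpr hodd) (even_iff_two_dvd.mpr hdvd)
      have : n = 3 := by omega
      subst this
      exact ⟨rfl, hdvd, hS⟩
  · left
    push Not at hS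
    obtain ⟨M, hM, hMs⟩ := hS
    have hnt : Nontrivial V := by
      by_contra h
      rw [not_nontrivial_iff_subsingleton] at h
      exact hMs 0 (by ext v; exact Subsingleton.elim _ _)
    obtain ⟨μ, hμ⟩ := Module.End.exists_eigenvalue M
    let W : Subrepresentation ρ := ⟨Module.End.eigenspace M μ, by
      intro g v hv
      rw [Module.End.mem_eigenspace_iff] at hv ⊢
      have := LinearMap.congr_fun (hM g) v
      simp only [Module.End.mul_apply] at this
      rw [← this, hv, map_smul]⟩
    have : NeZero (Nat.card G : ℂ) := ⟨by simp⟩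
    obtain ⟨W', hW'⟩ := exists_isCompl W
    have hW1 : W.toSubmodule ≠ ⊥ := hμ
    have hW2 : W.toSubmodule ≠ ⊤ := by
      intro h
      apply hMs μ
      ext v
      have : v ∈ W.toSubmodule := by rw [h]; trivial
      simpa using Module.End.mem_eigenspace_iff.mp this
    have hsup : W.toSubmodule ⊔ W'.toSubmodule = ⊤ := by
      rw [← Subrepresentation.toSubmodule_sup, hW'.sup_eq_top]; rfl
    have hinf : W.toSubmodule ⊓ W'.toSubmodule = ⊥ := by
      rw [← Subrepresentation.toSubmodule_inf, hW'.inf_eq_bot]; rfl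
    have hW2' : W'.toSubmodule ≠ ⊤ := by
      intro h
      rw [h, inf_top_eq] at hinf
      exact hW1 hinf
    have key : ∀ U : Subrepresentation ρ, U.toSubmodule ≠ ⊤ →
        ∀ a b, ∀ v ∈ U.toSubmodule, ρ a (ρ b v) = ρ b (ρ a v) := by
      intro U hU a b v hv
      have hlt : Module.finrank ℂ U.toSubmodule < n := hn ▸ Submodule.finrank_lt hU
      rcases ih _ hlt U.toSubmodule U.toRepresentation rfl (by omega) with h | h
      · exact congrArg Subtype.val (LinearMap.congr_fun (h a b) ⟨v, hv⟩)
      · omega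
    intro a b
    ext v
    have : v ∈ W.toSubmodule ⊔ W'.toSubmodule := by rw [hsup]; trivial
    obtain ⟨x, hx, y, hy, rfl⟩ := Submodule.mem_sup.mp this
    simp only [Module.End.mul_apply, map_add]
    rw [key W hW2 a b x hx, key W' hW2' a b y hy]

theorem stmt_4 (G : Type*) [Group G] [Finite G]
    (hna : ¬ ∀ a b : G, a * b = b * a)
    (hodd : Odd (Nat.card G)) (h3 : rdim G = 3) :
    3 ∣ Nat.card G ∧ IsCyclic (Subgroup.center G) := by
  cases nonempty_fintype G
  have hmem : (3 : ℕ) ∈ {n : ℕ | ∃ ρ : G →* GL (Fin n) ℂ, Function.Injective ρ} := by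
    rw [← h3]
    apply Nat.sInf_mem
    by_contra hne
    rw [Set.not_nonempty_iff_eq_empty] at hne
    rw [rdim, hne] at h3
    simp at h3
  obtain ⟨r, hr⟩ := hmem
  rw [Nat.card_eq_fintype_card] at hodd ⊢
  let ρ : Representation ℂ G (Fin 3 → ℂ) :=
    (Matrix.toLinAlgEquiv' : Matrix (Fin 3) (Fin 3) ℂ ≃ₐ[ℂ] _).toMulEquiv.toMonoidHom.comp
      ((Units.coeHom _).comp r)
  have hρ : Function.Injective ρ :=
    (Matrix.toLinAlgEquiv' : Matrix (Fin 3) (Fin 3) ℂ ≃ₐ[ℂ] _).injective.comp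
      (Units.val_injective.comp hr)
  rcases comm_or_scalar hodd 3 (Fin 3 → ℂ) ρ (by simp) le_rfl with h | ⟨-, hd, hS⟩
  · exact absurd (fun a b => hρ (by rw [map_mul, map_mul, h])) hna
  refine ⟨hd, ?_⟩
  have hz : ∀ z : Subgroup.center G, ∃ c : ℂ, ρ z = c • 1 := by
    intro z
    refine hS _ fun g => ?_
    rw [← map_mul, ← map_mul, Subgroup.mem_center_iff.mp z.2 g]
  choose f hf using hz
  have hinj : ∀ c c' : ℂ, c • (1 : Module.End ℂ (Fin 3 → ℂ)) = c' • 1 → c = c' := by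
    intro c c' h
    have := congrFun (LinearMap.congr_fun h (fun _ => 1)) 0
    simpa using this
  let F : Subgroup.center G →* ℂ :=
    { toFun := f
      map_one' := hinj _ _ (by rw [← hf]; simp)
      map_mul' := fun x y => hinj _ _ (by
        rw [← hf, Subgroup.coe_mul, map_mul, hf, hf, smul_mul_smul_comm, one_mul]) }
  refine isCyclic_of_injective_ringHom F ?_
  intro x y hxy
  apply Subtype.ext
  apply hρ
  rw [hf, hf]
  exact congrArg (fun c : ℂ => c • (1 : Module.End ℂ (Fin 3 → ℂ))) hxy
end

section
/- Let G be a finite nonabelian group that is minimally faithful of degree 3. Then: (a) every nonabelian proper subgroup of G has cyclic center; (b) every proper subgroup of G of odd order is abelian; (c) every abelian proper subgroup of G can be generated by at most 2 elements; (d) the order of G is divisible by 2 or by 3. -/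
open Matrix

lemma aux_dvd {G : Type*} [Group G] [Fintype G] {n : ℕ} (hn : 0 < n)
    (ρ : G →* Matrix (Fin n) (Fin n) ℂ)
    (hs : ∀ M : Matrix (Fin n) (Fin n) ℂ, (∀ g, ρ g * M = M * ρ g) → ∃ c : ℂ, M = c • 1) :
    n ∣ Fintype.card G := by
  classical
  have hn0 : (n : ℂ) ≠ 0 := by exact_mod_cast hn.ne'
  have havg : ∀ X : Matrix (Fin n) (Fin n) ℂ,
      ∑ g, ρ g * X * ρ g⁻¹ = ((Fintype.card G : ℂ) * X.trace / n) • 1 := by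
    intro X
    obtain ⟨c, hc⟩ := hs (∑ g, ρ g * X * ρ g⁻¹) (by
      intro h
      rw [Finset.mul_sum, Finset.sum_mul]
      refine Fintype.sum_equiv (Equiv.mulLeft h) _ _ ?_
      intro g
      simp only [Equiv.coe_mulLeft, _root_.mul_inv_rev, map_mul, mul_assoc]
      rw [← map_mul ρ h⁻¹ h]
      simp)
    rw [hc]
    have ht := congrArg Matrix.trace hc
    rw [Matrix.trace_sum] at ht
    have h1 : ∀ g, (ρ g * X * ρ g⁻¹).trace = X.trace := by
      intro g
      rw [Matrix.trace_mul_comm, ← mul_assoc, ← map_mul]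
      simp
    simp only [h1, Finset.sum_const, Finset.card_univ, Matrix.trace_smul, Matrix.trace_one,
      nsmul_eq_mul, smul_eq_mul, Fintype.card_fin] at ht
    congr 1
    rw [ht]
    field_simp
  have hent : ∀ i k l j, ∑ g, ρ g i k * ρ g⁻¹ l j =
      if k = l ∧ i = j then (Fintype.card G : ℂ) / n else 0 := by
    intro i k l j
    have := congrFun (congrFun (havg (Matrix.single k l (1:ℂ))) i) j
    rw [Matrix.sum_apply] at this
    have h2 : ∀ g, (ρ g * Matrix.single k l (1:ℂ) * ρ g⁻¹) i j = ρ g i k * ρ g⁻¹ l j := by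
      intro g
      rw [Matrix.mul_apply, Finset.sum_eq_single l]
      · simp
      · intro b _ hb
        simp [Matrix.mul_single_apply_of_ne _ _ _ _ _ hb]
      · simp
    simp only [h2] at this
    rw [this]
    by_cases hkl : k = l
    · subst hkl
      by_cases hij : i = j
      · subst hij; simp
      · simp [hij]
    · simp [hkl, Matrix.trace_single_eq_of_ne _ _ _ hkl]
  -- central element
  have hZ : ∑ g, (ρ g⁻¹).trace • ρ g = ((Fintype.card G : ℂ) / n) • 1 := by
    ext i k
    rw [Matrix.sum_apply]
    simp only [Matrix.smul_apply, smul_eq_mul, Matrix.trace, Matrix.diag, Finset.sum_mul]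
    rw [Finset.sum_comm]
    have : ∀ l, ∑ g, ρ g⁻¹ l l * ρ g i k = if k = l ∧ i = l then (Fintype.card G : ℂ) / n else 0 := by
      intro l
      rw [← hent]
      exact Finset.sum_congr rfl fun g _ => mul_comm _ _
    simp only [this]
    by_cases hik : i = k
    · subst hik; simp
    · simp only [Matrix.one_apply, hik, if_false, mul_zero]
      apply Finset.sum_eq_zero
      intro l _
      rw [if_neg]
      rintro ⟨rfl, rfl⟩
      exact hik rfl
  -- traces integral
  have hint : ∀ g, IsIntegral ℤ (ρ g).trace := by
    intro g
    rw [Matrix.trace_eq_sum_roots_charpoly]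
    refine IsIntegral.multiset_sum ?_
    intro x hx
    have hx' : x ∈ spectrum ℂ (ρ g) := by
      rw [Matrix.mem_spectrum_iff_isRoot_charpoly]
      exact (Polynomial.mem_roots'.1 hx).2
    have h3 : x ^ Fintype.card G ∈ spectrum ℂ (ρ g ^ Fintype.card G) :=
      spectrum.pow_mem_pow _ _ hx'
    rw [← map_pow, pow_card_eq_one, map_one] at h3
    have : Nonempty (Fin n) := ⟨⟨0, hn⟩⟩
    rw [spectrum.one_eq] at h3
    refine IsIntegral.of_pow (n := Fintype.card G) Fintype.card_pos ?_
    rw [Set.mem_singleton_iff.1 h3]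
    exact isIntegral_one
  let A := integralClosure ℤ ℂ
  let φ : MonoidAlgebra A G →ₐ[A] Matrix (Fin n) (Fin n) ℂ := MonoidAlgebra.lift A _ G ρ
  let z : MonoidAlgebra A G := ∑ g, MonoidAlgebra.single g (⟨(ρ g⁻¹).trace, hint g⁻¹⟩ : A)
  have hz : φ z = ((Fintype.card G : ℂ) / n) • 1 := by
    rw [← hZ]
    simp only [z, φ, map_sum, MonoidAlgebra.lift_single]
    rfl
  have hzi : IsIntegral A z := by
    exact Algebra.IsIntegral.isIntegral z
  have h4 : IsIntegral A (φ z) := hzi.map φ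
  rw [hz, ← Algebra.algebraMap_eq_smul_one] at h4
  have : Nonempty (Fin n) := ⟨⟨0, hn⟩⟩
  have h5 : IsIntegral A ((Fintype.card G : ℂ) / n) := by
    have hinj : Function.Injective ((IsScalarTower.toAlgHom A ℂ (Matrix (Fin n) (Fin n) ℂ))) := 
      (algebraMap ℂ (Matrix (Fin n) (Fin n) ℂ)).injective
    exact (isIntegral_algHom_iff (IsScalarTower.toAlgHom A ℂ (Matrix (Fin n) (Fin n) ℂ)) hinj).1 h4
  have h6 : IsIntegral ℤ ((Fintype.card G : ℂ) / n) := isIntegral_trans _ h5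
  have h7 : IsIntegral ℤ ((Fintype.card G : ℚ) / n) := by
    have hinj : Function.Injective (IsScalarTower.toAlgHom ℤ ℚ ℂ) := (algebraMap ℚ ℂ).injective
    refine (isIntegral_algHom_iff _ hinj).1 ?_
    simpa using h6
  obtain ⟨m, hm⟩ := IsIntegrallyClosed.isIntegral_iff.1 h7
  have hnq : (n : ℚ) ≠ 0 := by exact_mod_cast hn.ne'
  have h8 : (m : ℚ) * n = Fintype.card G := by
    have : (m : ℚ) = (Fintype.card G : ℚ) / n := by simpa using hm
    rw [this]; field_simp
  have h9 : m * (n : ℤ) = (Fintype.card G : ℤ) := by exact_mod_cast h8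
  exact Int.natCast_dvd_natCast.1 ⟨m, by rw [← h9, mul_comm]⟩

lemma aux_unip {R : Type*} [Ring R] [Algebra ℂ R] (c : R) (m : ℕ) (hm : 0 < m) (hc : c ^ m = 1)
    (h2 : (c - 1) * (c - 1) = 0) : c = 1 := by
  have key : ∀ k : ℕ, c ^ k = 1 + (k : ℂ) • (c - 1) := by
    intro k
    induction k with
    | zero => simp
    | succ k ih =>
      have : c = 1 + (c - 1) := by abel
      rw [pow_succ, ih]
      nth_rewrite 2 [this]
      rw [add_mul, mul_add, mul_add, smul_mul_assoc, smul_mul_assoc, h2]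
      push_cast
      rw [add_smul]
      simp
      abel
  have := key m
  rw [hc] at this
  have h3 : (m : ℂ) • (c - 1) = 0 := by simpa using this
  rcases smul_eq_zero.1 h3 with h | h
  · exact absurd h (by exact_mod_cast hm.ne')
  · exact sub_eq_zero.1 h

lemma aux_par (N : Matrix (Fin 2) (Fin 2) ℂ) (hN : N ≠ 0) (v w : Fin 2 → ℂ) (hv : v ≠ 0)
    (h1 : N *ᵥ v = 0) (h2 : N *ᵥ w = 0) : ∃ μ : ℂ, w = μ • v := by
  have hd : v 0 * w 1 - v 1 * w 0 = 0 := by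
    by_contra hd
    apply hN
    ext i j
    have e1 := congrFun h1 i
    have e2 := congrFun h2 i
    simp [Matrix.mulVec, dotProduct, Fin.sum_univ_two] at e1 e2
    have a0 : N i 0 * (v 0 * w 1 - v 1 * w 0) = 0 := by linear_combination w 1 * e1 - v 1 * e2
    have a1 : N i 1 * (v 0 * w 1 - v 1 * w 0) = 0 := by linear_combination v 0 * e2 - w 0 * e1
    have a0 := (mul_eq_zero.1 a0).resolve_right hd
    have a1 := (mul_eq_zero.1 a1).resolve_right hd
    fin_cases j
    · simpa using a0
    · simpa using a1
  by_cases h0 : v 0 = 0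
  · have h10 : v 1 ≠ 0 := by
      intro h10; apply hv; ext i; fin_cases i <;> simp [h0, h10]
    refine ⟨w 1 / v 1, ?_⟩
    ext i; fin_cases i
    · simp [h0]
      have : v 1 * w 0 = 0 := by linear_combination w 1 * h0 - hd
      exact (mul_eq_zero.1 this).resolve_left h10
    · simp; field_simp
  · refine ⟨w 0 / v 0, ?_⟩
    ext i; fin_cases i
    · simp; field_simp
    · simp; field_simp; linear_combination hd

lemma aux_cent (Z A B : Matrix (Fin 2) (Fin 2) ℂ) (hZ : ¬ ∃ c : ℂ, Z = c • 1)
    (hA : A * Z = Z * A) (hB : B * Z = Z * B) : A * B = B * A := by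
  have hz : ¬ (Z 0 0 = Z 1 1 ∧ Z 0 1 = 0 ∧ Z 1 0 = 0) := by
    rintro ⟨h1, h2, h3⟩
    apply hZ
    refine ⟨Z 0 0, ?_⟩
    ext i j; fin_cases i <;> fin_cases j <;> simp [*]
  have a := fun i j => congrFun (congrFun hA i) j
  have b := fun i j => congrFun (congrFun hB i) j
  simp [Matrix.mul_apply, Fin.sum_univ_two] at a b
  obtain ⟨⟨a00, a01⟩, a10, a11⟩ := a
  obtain ⟨⟨b00, b01⟩, b10, b11⟩ := b
  have k1 : A 0 1 * B 1 0 = A 1 0 * B 0 1 := by grind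
  have k2 : A 0 1 * (B 0 0 - B 1 1) = B 0 1 * (A 0 0 - A 1 1) := by grind
  have k3 : A 1 0 * (B 0 0 - B 1 1) = B 1 0 * (A 0 0 - A 1 1) := by grind
  ext i j; fin_cases i <;> fin_cases j <;> simp [Matrix.mul_apply, Fin.sum_univ_two] <;> grind

/-- generation of a group by two elements -/
lemma aux_two_gen {H : Type*} [Group H] [Finite H] (hcomm : ∀ a b : H, a * b = b * a)
    (f d : H →* ℂˣ) (hfd : ∀ h, f h = 1 → d h = 1 → h = 1) :
    ∃ a b : H, (⊤ : Subgroup H) = Subgroup.closure {a, b} := by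
  have hfin : Finite f.range := Set.finite_range f |>.to_subtype
  have hc1 : IsCyclic f.range :=
    isCyclic_of_subgroup_isDomain ((Units.coeHom ℂ).comp f.range.subtype)
      (Units.val_injective.comp f.range.subtype_injective)
  have hc2 : IsCyclic f.ker := by
    refine isCyclic_of_subgroup_isDomain ((Units.coeHom ℂ).comp (d.comp f.ker.subtype)) ?_
    apply Units.val_injective.comp
    show Function.Injective (d.comp f.ker.subtype)
    rw [injective_iff_map_eq_one]
    rintro ⟨x, hx⟩ h
    ext
    exact hfd x hx h
  obtain ⟨⟨_, a, rfl⟩, ha⟩ := hc1.exists_generator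
  obtain ⟨⟨b, hbk⟩, hb⟩ := hc2.exists_generator
  refine ⟨a, b, ?_⟩
  symm
  rw [eq_top_iff]
  intro h _
  obtain ⟨k, hk⟩ := Subgroup.mem_zpowers_iff.1 (ha ⟨f h, h, rfl⟩)
  have hk' : f a ^ k = f h := congrArg Subtype.val hk
  have hker : (a ^ k)⁻¹ * h ∈ f.ker := by
    rw [MonoidHom.mem_ker]; simp [hk']
  obtain ⟨l, hl⟩ := Subgroup.mem_zpowers_iff.1 (hb ⟨_, hker⟩)
  have hl' : b ^ l = (a ^ k)⁻¹ * h := congrArg Subtype.val hl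
  have : h = a ^ k * b ^ l := by rw [hl']; group
  rw [this]
  exact mul_mem (zpow_mem (Subgroup.subset_closure (by simp)) _)
    (zpow_mem (Subgroup.subset_closure (by simp)) _)

lemma aux_char {H : Type*} [Group H] (ρ : H →* GL (Fin 2) ℂ)
    (v : Fin 2 → ℂ) (hv : v ≠ 0) (hev : ∀ h, ∃ μ : ℂ, (ρ h : Matrix _ _ ℂ) *ᵥ v = μ • v) :
    ∃ f : H →* ℂˣ, ∀ h, (ρ h : Matrix _ _ ℂ) *ᵥ v = (f h : ℂ) • v := by
  choose m hm using hev
  have h1 : m 1 = 1 := by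
    have := hm 1
    simp at this
    have h2 : (1 : ℂ) • v = m 1 • v := by simpa using this
    exact (smul_left_injective ℂ hv h2).symm
  have hmul : ∀ a b, m (a * b) = m a * m b := by
    intro a b
    have := hm (a * b)
    rw [map_mul, Units.val_mul, ← Matrix.mulVec_mulVec, hm b, Matrix.mulVec_smul, hm a, smul_smul] at this
    rw [mul_comm (m a)]
    exact (smul_left_injective ℂ hv this).symm
  let F : H →* ℂ := ⟨⟨m, h1⟩, hmul⟩
  exact ⟨F.toHomUnits, fun h => hm h⟩

lemma aux_abelian {H : Type*} [Group H] [Finite H] (hcomm : ∀ a b : H, a * b = b * a)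
    (ρ : H →* GL (Fin 2) ℂ) (hρ : Function.Injective ρ) :
    ∃ a b : H, (⊤ : Subgroup H) = Subgroup.closure {a, b} := by
  obtain ⟨v, hv, hev⟩ : ∃ v : Fin 2 → ℂ, v ≠ 0 ∧
      ∀ h, ∃ μ : ℂ, (ρ h : Matrix _ _ ℂ) *ᵥ v = μ • v := by
    by_cases hs : ∀ h, ∃ c : ℂ, (ρ h : Matrix (Fin 2) (Fin 2) ℂ) = c • 1
    · refine ⟨fun _ => 1, fun h => one_ne_zero (congrFun h 0), fun h => ?_⟩
      obtain ⟨c, hc⟩ := hs h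
      exact ⟨c, by rw [hc, Matrix.smul_mulVec, Matrix.one_mulVec]⟩
    · push Not at hs
      obtain ⟨z, hz⟩ := hs
      obtain ⟨c, hc⟩ := Module.End.exists_eigenvalue (Matrix.toLin' (ρ z : Matrix (Fin 2) (Fin 2) ℂ))
      obtain ⟨v, hv⟩ := hc.exists_hasEigenvector
      have hvz : (ρ z : Matrix (Fin 2) (Fin 2) ℂ) *ᵥ v = c • v := by
        simpa using hv.apply_eq_smul
      refine ⟨v, hv.2, fun h => ?_⟩
      apply aux_par ((ρ z : Matrix (Fin 2) (Fin 2) ℂ) - c • 1) (sub_ne_zero.2 (hz c)) v _ hv.2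
      · rw [Matrix.sub_mulVec, hvz, Matrix.smul_mulVec, Matrix.one_mulVec, sub_self]
      · rw [Matrix.sub_mulVec, Matrix.mulVec_mulVec, ← Units.val_mul, ← map_mul, hcomm z h, map_mul,
          Units.val_mul, ← Matrix.mulVec_mulVec, hvz, Matrix.smul_mulVec, Matrix.one_mulVec,
          Matrix.mulVec_smul, sub_self]
  obtain ⟨f, hf⟩ := aux_char ρ v hv hev
  refine aux_two_gen hcomm f (Matrix.GeneralLinearGroup.det.comp ρ) ?_
  intro h h1 h2
  apply hρ
  rw [map_one]
  apply Units.ext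
  have hdet : (ρ h : Matrix (Fin 2) (Fin 2) ℂ).det = 1 := by
    simpa using congrArg Units.val h2
  have hfv := hf h
  rw [h1] at hfv
  have h0 : ((ρ h : Matrix (Fin 2) (Fin 2) ℂ) - 1).det = 0 := by
    apply Matrix.exists_mulVec_eq_zero_iff.1
    exact ⟨v, hv, by rw [Matrix.sub_mulVec, hfv]; simp⟩
  refine aux_unip _ (Nat.card H) Nat.card_pos ?_ ?_
  · rw [← Units.val_pow_eq_pow_val, ← map_pow, pow_card_eq_one']; simp
  · generalize (ρ h : Matrix (Fin 2) (Fin 2) ℂ) = M at *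
    rw [Matrix.det_fin_two] at hdet h0
    simp at h0
    ext i j; fin_cases i <;> fin_cases j <;> simp [Matrix.mul_apply, Fin.sum_univ_two] <;> grind

lemma aux_a {H : Type*} [Group H] [Finite H] (hna : ¬ ∀ a b : H, a * b = b * a)
    (ρ : H →* GL (Fin 2) ℂ) (hρ : Function.Injective ρ) : IsCyclic (Subgroup.center H) := by
  have hs : ∀ z ∈ Subgroup.center H, ∃ c : ℂ, (ρ z : Matrix (Fin 2) (Fin 2) ℂ) = c • 1 := by
    intro z hz
    by_contra hc
    apply hna
    intro a b
    apply hρ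
    apply Units.ext
    have hh : ∀ a, (ρ a : Matrix (Fin 2) (Fin 2) ℂ) * ρ z = ρ z * ρ a := by
      intro a
      rw [← Units.val_mul, ← Units.val_mul, ← map_mul, ← map_mul, Subgroup.mem_center_iff.1 hz a]
    rw [map_mul, map_mul]
    exact aux_cent _ _ _ hc (hh a) (hh b)
  have hs' : ∀ z : Subgroup.center H, ∃ c : ℂ, (ρ z : Matrix (Fin 2) (Fin 2) ℂ) = c • 1 :=
    fun z => hs z z.2
  have hv : (fun _ => 1 : Fin 2 → ℂ) ≠ 0 := fun h => one_ne_zero (congrFun h 0)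
  obtain ⟨f, hf⟩ := aux_char (ρ.comp (Subgroup.center H).subtype) (fun _ => 1) hv (fun z => by
    obtain ⟨c, hc⟩ := hs' z
    refine ⟨c, ?_⟩
    simp only [MonoidHom.comp_apply, Subgroup.subtype_apply]
    rw [hc, Matrix.smul_mulVec, Matrix.one_mulVec])
  refine isCyclic_of_subgroup_isDomain ((Units.coeHom ℂ).comp f) ?_
  apply Units.val_injective.comp
  show Function.Injective f
  rw [injective_iff_map_eq_one]
  intro z hz
  obtain ⟨c, hc⟩ := hs' z
  have := hf z
  simp only [MonoidHom.comp_apply, Subgroup.subtype_apply] at this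
  rw [hc, hz, Matrix.smul_mulVec, Matrix.one_mulVec] at this
  have hc1 : c = 1 := by simpa using congrFun this 0
  rw [hc1, one_smul] at hc
  ext
  apply hρ
  apply Units.ext
  rw [hc]; simp
lemma aux_comm {G : Type*} [Group G] [Fintype G] (d : ℕ) :
    ∀ (V : Type) [AddCommGroup V] [Module ℂ V] [FiniteDimensional ℂ V]
    (_ : Module.finrank ℂ V = d) (_ : ∀ k, 2 ≤ k → k ≤ d → ¬ k ∣ Fintype.card G)
    (ρ : Representation ℂ G V) (a b : G), ρ (a * b) = ρ (b * a) := by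
  induction d using Nat.strong_induction_on with
  | _ d ih =>
  intro V _ _ _ hd hk ρ a b
  by_cases hs : ∀ M : V →ₗ[ℂ] V, (∀ g, ρ g * M = M * ρ g) → ∃ c : ℂ, M = c • 1
  · -- scalar commutant
    have hd1 : d = 0 ∨ 0 < d := Nat.eq_zero_or_pos d
    rcases hd1 with rfl | hpos
    · have := Module.finrank_zero_iff.1 hd
      ext x
      exact Subsingleton.elim _ _
    let e : V ≃ₗ[ℂ] (Fin d → ℂ) := LinearEquiv.ofFinrankEq _ _ (by simp [hd])
    let bs : Module.Basis (Fin d) ℂ V := Module.Basis.ofEquivFun e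
    let T : (V →ₗ[ℂ] V) ≃ₐ[ℂ] Matrix (Fin d) (Fin d) ℂ := LinearMap.toMatrixAlgEquiv bs
    have hdvd := aux_dvd hpos ((T : (V →ₗ[ℂ] V) →* Matrix (Fin d) (Fin d) ℂ).comp ρ) (by
      intro M hM
      obtain ⟨c, hc⟩ := hs (T.symm M) (by
        intro g
        apply T.injective
        have := hM g
        simpa using this)
      refine ⟨c, ?_⟩
      have := congrArg T hc
      simpa using this)
    have hd1 : d = 1 := by
      by_contra hne
      exact hk d (by omega) le_rfl hdvd
    subst hd1
    have hcm : ∀ A B : Matrix (Fin 1) (Fin 1) ℂ, A * B = B * A := by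
      intro A B
      ext i j
      fin_cases i; fin_cases j
      simp [Matrix.mul_apply, mul_comm]
    rw [map_mul, map_mul]
    apply T.injective
    rw [map_mul, map_mul, hcm]
  · push Not at hs
    obtain ⟨M, hM, hns⟩ := hs
    have : Nontrivial V := by
      by_contra hnt
      rw [not_nontrivial_iff_subsingleton] at hnt
      exact hns 0 (by ext x; exact Subsingleton.elim _ _)
    obtain ⟨c, hc⟩ := Module.End.exists_eigenvalue M
    let W : Submodule ℂ V := Module.End.eigenspace M c
    have hWbot : W ≠ ⊥ := hc
    have hWtop : W ≠ ⊤ := by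
      intro h
      apply hns c
      ext x
      have : x ∈ W := h ▸ Submodule.mem_top
      simpa using Module.End.mem_eigenspace_iff.1 this
    have hinv : ∀ g, ∀ x ∈ W, ρ g x ∈ W := by
      intro g x hx
      rw [Module.End.mem_eigenspace_iff] at hx ⊢
      have := LinearMap.congr_fun (hM g) x
      simp only [Module.End.mul_apply] at this
      rw [← this, hx, map_smul]
    let ρ1 : Representation ℂ G W :=
      { toFun := fun g => (ρ g).restrict (hinv g)
        map_one' := by ext x; simp
        map_mul' := by intro x y; ext z; simp }
    let ρ2 : Representation ℂ G (V ⧸ W) :=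
      { toFun := fun g => W.mapQ W (ρ g) (fun x hx => hinv g x hx)
        map_one' := by ext x; simp
        map_mul' := by intro x y; ext z; simp }
    have hlt1 : Module.finrank ℂ W < d := hd ▸ Submodule.finrank_lt hWtop
    have hlt2 : Module.finrank ℂ (V ⧸ W) < d := by
      have h1 := Submodule.finrank_quotient_add_finrank W
      have h2 : 0 < Module.finrank ℂ W := by
        rw [Nat.pos_iff_ne_zero]
        intro h; exact hWbot (Submodule.finrank_eq_zero.1 h)
      omega
    have c1 := ih _ hlt1 W rfl (fun k h1 h2 => hk k h1 (by omega)) ρ1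
    have c2 := ih _ hlt2 (V ⧸ W) rfl (fun k h1 h2 => hk k h1 (by omega)) ρ2
    have hcW : ∀ x ∈ W, ρ (a * b * (b * a)⁻¹) x = x := by
      intro x hx
      have h1 : ρ1 (a * b * (b * a)⁻¹) = 1 := by
        rw [map_mul, c1 a b, ← map_mul]; simp
      have := congrArg Subtype.val (LinearMap.congr_fun h1 ⟨x, hx⟩)
      simpa [ρ1] using this
    have hcQ : ∀ x, ρ (a * b * (b * a)⁻¹) x - x ∈ W := by
      intro x
      have h1 : ρ2 (a * b * (b * a)⁻¹) = 1 := by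
        rw [map_mul, c2 a b, ← map_mul]; simp
      have := LinearMap.congr_fun h1 (Submodule.Quotient.mk x)
      exact (Submodule.Quotient.eq W).1 this
    have hone : ρ (a * b * (b * a)⁻¹) = 1 := by
      refine aux_unip (R := V →ₗ[ℂ] V) _ (Fintype.card G) Fintype.card_pos ?_ ?_
      · rw [← map_pow, pow_card_eq_one, map_one]
      · ext x
        have := hcW _ (hcQ x)
        simp only [Module.End.mul_apply, LinearMap.sub_apply, Module.End.one_apply,
          LinearMap.zero_apply]
        rw [this, sub_self]
    have : a * b = (a * b * (b * a)⁻¹) * (b * a) := by group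
    rw [this, map_mul, hone, one_mul]

lemma aux_comm' {G : Type*} [Group G] [Finite G] (d : ℕ) (ρ : G →* GL (Fin d) ℂ)
    (hρ : Function.Injective ρ) (hk : ∀ k, 2 ≤ k → k ≤ d → ¬ k ∣ Nat.card G) :
    ∀ a b : G, a * b = b * a := by
  intro a b
  have := Fintype.ofFinite G
  rw [Nat.card_eq_fintype_card] at hk
  let T : (Matrix (Fin d) (Fin d) ℂ) ≃ₐ[ℂ] ((Fin d → ℂ) →ₗ[ℂ] (Fin d → ℂ)) := Matrix.toLinAlgEquiv'
  have := aux_comm d (Fin d → ℂ) (by simp) hk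
    ((T : (Matrix (Fin d) (Fin d) ℂ) →* ((Fin d → ℂ) →ₗ[ℂ] (Fin d → ℂ))).comp
      ((Units.coeHom _).comp ρ)) a b
  apply hρ
  apply Units.ext
  exact T.injective this

lemma aux_rdim {H : Type*} [Group H] (hne : ∃ n, ∃ ρ : H →* GL (Fin n) ℂ, Function.Injective ρ)
    (h : rdim H < 3) : ∃ ρ : H →* GL (Fin 2) ℂ, Function.Injective ρ := by
  obtain ⟨ρ, hρ⟩ : ∃ ρ : H →* GL (Fin (rdim H)) ℂ, Function.Injective ρ :=
    Nat.sInf_mem (s := {n : ℕ | ∃ ρ : H →* GL (Fin n) ℂ, Function.Injective ρ}) hne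
  generalize rdim H = n at *
  interval_cases n
  · refine ⟨1, fun a b _ => hρ ?_⟩
    apply Units.ext
    ext i
    exact i.elim0
  · refine ⟨(Units.map (Matrix.scalar (Fin 2) : ℂ →+* Matrix (Fin 2) (Fin 2) ℂ).toMonoidHom).comp
      (Matrix.GeneralLinearGroup.det.comp ρ), fun a b hab => hρ ?_⟩
    apply Units.ext
    have h0 : (Matrix.scalar (Fin 2) ((ρ a : Matrix (Fin 1) (Fin 1) ℂ).det)) =
        (Matrix.scalar (Fin 2) ((ρ b : Matrix (Fin 1) (Fin 1) ℂ).det)) := congrArg Units.val hab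
    have h1 := congrArg (fun M : Matrix (Fin 2) (Fin 2) ℂ => M 0 0) h0
    simp [Matrix.scalar_apply] at h1
    ext i j
    fin_cases i; fin_cases j
    simpa using h1
  · exact ⟨ρ, hρ⟩

theorem stmt_5 (G : Type*) [Group G] [Finite G]
    (hna : ¬ ∀ a b : G, a * b = b * a) (h : MinFaithful G 3) :
    (∀ H : Subgroup G, H ≠ ⊤ → (¬ ∀ a b : H, a * b = b * a) →
        IsCyclic (Subgroup.center H)) ∧
    (∀ H : Subgroup G, H ≠ ⊤ → Odd (Nat.card H) → ∀ a b : H, a * b = b * a) ∧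
    (∀ H : Subgroup G, H ≠ ⊤ → (∀ a b : H, a * b = b * a) →
        ∃ a b : G, H = Subgroup.closure {a, b}) ∧
    (2 ∣ Nat.card G ∨ 3 ∣ Nat.card G) := by
  obtain ⟨h3, hlt⟩ := h
  have hne : {n : ℕ | ∃ ρ : G →* GL (Fin n) ℂ, Function.Injective ρ}.Nonempty := by
    by_contra hc
    rw [Set.not_nonempty_iff_eq_empty] at hc
    unfold rdim at h3
    rw [hc] at h3
    simp at h3
  obtain ⟨ρ, hρ⟩ : ∃ ρ : G →* GL (Fin 3) ℂ, Function.Injective ρ := by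
    have := Nat.sInf_mem hne
    change sInf {n : ℕ | ∃ ρ : G →* GL (Fin n) ℂ, Function.Injective ρ} = 3 at h3
    rw [h3] at this
    exact this
  have hsub : ∀ H : Subgroup G, H ≠ ⊤ → ∃ ρ : H →* GL (Fin 2) ℂ, Function.Injective ρ :=
    fun H hH => aux_rdim ⟨3, ρ.comp H.subtype, hρ.comp H.subtype_injective⟩ (hlt H hH)
  refine ⟨?_, ?_, ?_, ?_⟩
  · intro H hH hn
    obtain ⟨σ, hσ⟩ := hsub H hH
    exact aux_a hn σ hσ
  · intro H hH hodd
    obtain ⟨σ, hσ⟩ := hsub H hH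
    refine aux_comm' 2 σ hσ ?_
    intro k h1 h2
    obtain rfl : k = 2 := by omega
    exact hodd.not_two_dvd_nat
  · intro H hH hc
    obtain ⟨σ, hσ⟩ := hsub H hH
    obtain ⟨a, b, hab⟩ := aux_abelian hc σ hσ
    refine ⟨a, b, ?_⟩
    have := congrArg (Subgroup.map H.subtype) hab
    rw [MonoidHom.map_closure, ← MonoidHom.range_eq_map, Subgroup.range_subtype] at this
    simpa [Set.image_pair] using this
  · by_contra hc
    push Not at hc
    apply hna
    refine aux_comm' 3 ρ hρ ?_
    intro k h1 h2
    interval_cases k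
    · exact hc.1
    · exact hc.2
end
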